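/- arXiv:1606.06138 — 2 statements merged into one kernel-verified Lean document; each statement's English description precedes it below -/
import Mathlib

section
/- Let M ⊂ ℝ^{n+1} be a smooth, weakly convex hypersurface (embedded n-disk) perpendicular to S^n from the inside, with embedding vector X. Then either ∂M is an equator of the sphere S^n, or there exists an interior point x ∈ int(𝔻) at which the second fundamental form of M is positive definite. -/
open Metric Set MeasureTheory Filter
open scoped RealInnerProductSpace ENNReal NNReal

noncomputable section

/-- Euclidean space `ℝ^n`. -/
abbrev Euc (n : ℕ) := EuclideanSpace ℝ (Fin n)

/-- The closed unit `n`-disk `𝔻`. -/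
def Disk (n : ℕ) : Set (Euc n) := Metric.closedBall 0 1

/-- The boundary `∂𝔻` of the unit disk, i.e. the unit sphere `S^{n-1} ⊂ ℝ^n`. -/
def DiskBdry (n : ℕ) : Set (Euc n) := Metric.sphere 0 1

/-- A smoothly embedded `n`-disk hypersurface `M ⊂ ℝ^{n+1}`, given by a smooth embedding
`X : 𝔻 → ℝ^{n+1}` (presented by a map defined on all of `ℝ^n`, smooth, injective and
immersive on `𝔻`) together with a chosen smooth unit normal field `N`. -/
structure HypDisk (n : ℕ) where
  X : Euc n → Euc (n+1)
  N : Euc n → Euc (n+1)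
  smoothX : ContDiffOn ℝ (⊤ : ℕ∞) X (Disk n)
  smoothN : ContDiffOn ℝ (⊤ : ℕ∞) N (Disk n)
  injX : Set.InjOn X (Disk n)
  immersion : ∀ x ∈ Disk n, Function.Injective (fderivWithin ℝ X (Disk n) x)
  unitN : ∀ x ∈ Disk n, ‖N x‖ = 1
  perpN : ∀ x ∈ Disk n, ∀ v : Euc n, ⟪fderivWithin ℝ X (Disk n) x v, N x⟫ = 0

variable {n : ℕ}

/-- The induced metric `g_ij = ⟨∂_i X, ∂_j X⟩`. -/
def gmet (S : HypDisk n) (x : Euc n) : Matrix (Fin n) (Fin n) ℝ :=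
  Matrix.of fun i j =>
    ⟪fderivWithin ℝ S.X (Disk n) x (EuclideanSpace.single i 1),
      fderivWithin ℝ S.X (Disk n) x (EuclideanSpace.single j 1)⟫

/-- The second fundamental form `h_ij = -⟨∂_i ∂_j X, N⟩`. -/
def sff (S : HypDisk n) (x : Euc n) : Matrix (Fin n) (Fin n) ℝ :=
  Matrix.of fun i j =>
    -⟪fderivWithin ℝ (fun y => fderivWithin ℝ S.X (Disk n) y (EuclideanSpace.single i 1))
        (Disk n) x (EuclideanSpace.single j 1), S.N x⟫

/-- The mean curvature `H = g^{ij} h_ij`. -/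
def meanCurv (S : HypDisk n) (x : Euc n) : ℝ := ((gmet S x)⁻¹ * sff S x).trace

/-- `M` is (weakly) convex: the second fundamental form is positive semidefinite everywhere. -/
def WeaklyConvex (S : HypDisk n) : Prop := ∀ x ∈ Disk n, (sff S x).PosSemidef

/-- `M` is strictly convex: the second fundamental form is positive definite everywhere. -/
def StrictlyConvex (S : HypDisk n) : Prop := ∀ x ∈ Disk n, (sff S x).PosDef

/-- `M` is perpendicular to the sphere `S^n` from the inside: `∂M ⊂ S^n`, the normal `N` of `M`
is orthogonal to the outward normal `Ñ(x) = x` of `S^n` along `∂M`, and `⟨γ'(0), Ñ⟩ ≥ 0` for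
every `C¹` curve `γ : (-ε, 0] → M` ending on `∂M`. -/
def PerpFromInside (S : HypDisk n) : Prop :=
  (∀ x ∈ DiskBdry n, S.X x ∈ Metric.sphere (0 : Euc (n+1)) 1) ∧
  (∀ x ∈ DiskBdry n, ⟪S.N x, S.X x⟫ = 0) ∧
  (∀ (γ : ℝ → Euc (n+1)) (ε : ℝ), 0 < ε →
    ContDiffOn ℝ 1 γ (Set.Icc (-ε) 0) →
    (∀ t ∈ Set.Icc (-ε) 0, γ t ∈ S.X '' Disk n) →
    γ 0 ∈ S.X '' DiskBdry n →
    ∀ v : Euc (n+1), HasDerivWithinAt γ v (Set.Icc (-ε) 0) 0 →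
      0 ≤ ⟪v, γ 0⟫)

/-- The surface area `|M|`, the `n`-dimensional Hausdorff measure of `M = X(𝔻)`. -/
def area (S : HypDisk n) : ℝ := (μH[n] (S.X '' Disk n)).toReal

/-- The boundary area `|∂M|`, the `(n-1)`-dimensional Hausdorff measure of `∂M = X(∂𝔻)`. -/
def bdryArea (S : HypDisk n) : ℝ := (μH[(n : ℝ) - 1] (S.X '' DiskBdry n)).toReal

/-- The surface integral `∫_M f dμ`, computed parametrically by the area formula. -/
def surfIntegral (S : HypDisk n) (f : Euc n → ℝ) : ℝ :=
  ∫ x in Disk n, f x * Real.sqrt (gmet S x).det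

/-- `ω_n`, the volume of the `n`-dimensional unit ball. -/
def ballVol (n : ℕ) : ℝ := (volume (Metric.closedBall (0 : Euc n) 1)).toReal

/-- `|S^{n-1}|`, the `(n-1)`-dimensional measure of the unit sphere in `ℝ^n`. -/
def sphereArea (n : ℕ) : ℝ := (μH[(n : ℝ) - 1] (Metric.sphere (0 : Euc n) 1)).toReal

/-- An equator of the sphere `S^m ⊂ ℝ^{m+1}`: the intersection of the unit sphere with a
hyperplane through the origin. -/
def IsEquator {m : ℕ} (s : Set (Euc m)) : Prop :=
  ∃ v : Euc m, v ≠ 0 ∧ s = {y ∈ Metric.sphere (0 : Euc m) 1 | ⟪y, v⟫ = 0}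

/-- A smooth solution of the inverse mean curvature flow `∂X/∂t = N/H` on `[0, T)` with free
boundary on the sphere `S^n`: each time slice is a hypersurface perpendicular to `S^n` from
the inside. -/
structure IMCFSol (n : ℕ) (T : ℝ) where
  M : ℝ → HypDisk n
  T_pos : 0 < T
  perp : ∀ t ∈ Set.Ico (0 : ℝ) T, PerpFromInside (M t)
  H_pos : ∀ t ∈ Set.Ico (0 : ℝ) T, ∀ x ∈ Disk n, 0 < meanCurv (M t) x
  smooth : ContDiffOn ℝ (⊤ : ℕ∞) (fun p : ℝ × Euc n => (M p.1).X p.2)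
    (Set.Ico (0 : ℝ) T ×ˢ Disk n)
  evol : ∀ t ∈ Set.Ico (0 : ℝ) T, ∀ x ∈ Disk n,
    HasDerivWithinAt (fun s => (M s).X x) ((meanCurv (M t) x)⁻¹ • (M t).N x)
      (Set.Ico (0 : ℝ) T) t

/-- The solution on `[0, T)` is maximal: no solution with the same initial embedding exists on
a longer time interval. -/
def IMCFSol.IsMaximal {n : ℕ} {T : ℝ} (sol : IMCFSol n T) : Prop :=
  ∀ (T' : ℝ) (sol' : IMCFSol n T'), (sol'.M 0).X = (sol.M 0).X → T' ≤ T

/-- A smooth solution of the mean curvature flow `∂F/∂t = -H·N` on `[0, T)` with free boundary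
on the sphere `S^n`: each time slice is a hypersurface perpendicular to `S^n` from the inside. -/
structure MCFSol (n : ℕ) (T : ℝ) where
  M : ℝ → HypDisk n
  T_pos : 0 < T
  perp : ∀ t ∈ Set.Ico (0 : ℝ) T, PerpFromInside (M t)
  smooth : ContDiffOn ℝ (⊤ : ℕ∞) (fun p : ℝ × Euc n => (M p.1).X p.2)
    (Set.Ico (0 : ℝ) T ×ˢ Disk n)
  evol : ∀ t ∈ Set.Ico (0 : ℝ) T, ∀ x ∈ Disk n,
    HasDerivWithinAt (fun s => (M s).X x) (-(meanCurv (M t) x) • (M t).N x)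
      (Set.Ico (0 : ℝ) T) t


open scoped Topology

namespace HypDisk

variable (S : HypDisk n) {x : Euc n}

/-- The differential of the embedding of a hypersurface disk. -/
def dX (x : Euc n) : Euc n →L[ℝ] Euc (n + 1) := fderivWithin ℝ S.X (Disk n) x

/-- The differential of the unit normal of a hypersurface disk. -/
def dN (x : Euc n) : Euc n →L[ℝ] Euc (n + 1) := fderivWithin ℝ S.N (Disk n) x

lemma uniqueDiffOn_disk : UniqueDiffOn ℝ (Disk n) :=
  uniqueDiffOn_convex (convex_closedBall _ _) (by
    rw [Disk, interior_closedBall _ one_ne_zero]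
    exact nonempty_ball.2 one_pos)

lemma isCompact_disk : IsCompact (Disk n) := isCompact_closedBall _ _

lemma disk_mem_nhds (hx : x ∈ ball (0 : Euc n) 1) : Disk n ∈ 𝓝 x :=
  mem_of_superset (isOpen_ball.mem_nhds hx) ball_subset_closedBall

lemma hasFDerivWithinAt_X (hx : x ∈ Disk n) : HasFDerivWithinAt S.X (S.dX x) (Disk n) x :=
  (S.smoothX.differentiableOn (by simp) x hx).hasFDerivWithinAt

lemma hasFDerivWithinAt_N (hx : x ∈ Disk n) : HasFDerivWithinAt S.N (S.dN x) (Disk n) x :=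
  (S.smoothN.differentiableOn (by simp) x hx).hasFDerivWithinAt

lemma hasFDerivAt_X (hx : x ∈ ball (0 : Euc n) 1) : HasFDerivAt S.X (S.dX x) x :=
  (S.hasFDerivWithinAt_X (ball_subset_closedBall hx)).hasFDerivAt (disk_mem_nhds hx)

lemma hasFDerivAt_N (hx : x ∈ ball (0 : Euc n) 1) : HasFDerivAt S.N (S.dN x) x :=
  (S.hasFDerivWithinAt_N (ball_subset_closedBall hx)).hasFDerivAt (disk_mem_nhds hx)

lemma continuousOn_X : ContinuousOn S.X (Disk n) := S.smoothX.continuousOn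

lemma continuousOn_N : ContinuousOn S.N (Disk n) := S.smoothN.continuousOn

/-- The derivative of `y ↦ dX y v`. -/
def ddX (x v : Euc n) : Euc n →L[ℝ] Euc (n + 1) :=
  fderivWithin ℝ (fun y => fderivWithin ℝ S.X (Disk n) y v) (Disk n) x

lemma hasFDerivWithinAt_dX (hx : x ∈ Disk n) (v : Euc n) :
    HasFDerivWithinAt (fun y => S.dX y v) (S.ddX x v) (Disk n) x := by
  have h : ContDiffOn ℝ 1 (fun y => fderivWithin ℝ S.X (Disk n) y) (Disk n) :=
    S.smoothX.fderivWithin uniqueDiffOn_disk (by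
      rw [one_add_one_eq_two]
      exact WithTop.coe_le_coe.2 le_top)
  exact ((h.clm_apply contDiffOn_const).differentiableOn (by simp) x hx).hasFDerivWithinAt

lemma inner_ddX_N (hx : x ∈ Disk n) (v w : Euc n) :
    ⟪S.ddX x v w, S.N x⟫ = -⟪S.dX x v, S.dN x w⟫ := by
  have h := (S.hasFDerivWithinAt_dX hx v).inner ℝ (S.hasFDerivWithinAt_N hx)
  have h0 : HasFDerivWithinAt (fun y => ⟪S.dX y v, S.N y⟫) (0 : Euc n →L[ℝ] ℝ) (Disk n) x :=
    (hasFDerivWithinAt_const (0 : ℝ) x _).congr (fun y hy => S.perpN y hy v) (S.perpN x hx v)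
  have := congrArg (fun L : Euc n →L[ℝ] ℝ => L w) ((uniqueDiffOn_disk x hx).eq h h0)
  simp [fderivInnerCLM_apply] at this
  linarith

lemma sff_quadratic (hx : x ∈ Disk n) (w : Euc n) :
    w.ofLp ⬝ᵥ (sff S x).mulVec w.ofLp = ⟪S.dX x w, S.dN x w⟫ := by
  have key : ∀ i j, sff S x i j =
      ⟪S.dX x (EuclideanSpace.single i 1), S.dN x (EuclideanSpace.single j 1)⟫ := fun i j =>
    neg_eq_iff_eq_neg.2 (S.inner_ddX_N hx _ _)
  have hw : w = ∑ i, w i • EuclideanSpace.single i (1 : ℝ) := by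
    simpa using ((EuclideanSpace.basisFun (Fin n) ℝ).sum_repr w).symm
  conv_rhs => rw [hw]
  simp only [map_sum, map_smul, sum_inner, inner_sum, inner_smul_left, inner_smul_right,
    dotProduct, Matrix.mulVec, key, Finset.mul_sum]
  rw [Finset.sum_comm]
  refine Finset.sum_congr rfl fun i _ => Finset.sum_congr rfl fun j _ => ?_
  simp
  ring

lemma inner_dX_dN_nonneg (hconv : WeaklyConvex S) (hx : x ∈ Disk n) (w : Euc n) :
    0 ≤ ⟪S.dX x w, S.dN x w⟫ := by
  rw [← S.sff_quadratic hx]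
  simpa using (hconv x hx).dotProduct_mulVec_nonneg w.ofLp

/-- Since the tangent space has codimension one, any nonzero vector orthogonal to it spans its
orthogonal complement. -/
lemma exists_dX_eq (hx : x ∈ Disk n) {ν y : Euc (n + 1)} (hν : ν ≠ 0)
    (hperp : ∀ v, ⟪S.dX x v, ν⟫ = 0) (hy : ⟪y, ν⟫ = 0) : ∃ v, S.dX x v = y := by
  have hle : LinearMap.range (S.dX x).toLinearMap ≤ (ℝ ∙ ν)ᗮ := by
    rintro _ ⟨v, rfl⟩
    rw [Submodule.mem_orthogonal_singleton_iff_inner_left]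
    exact hperp v
  have hfin : Module.finrank ℝ (ℝ ∙ ν)ᗮ = n := by
    have : Fact (Module.finrank ℝ (Euc (n + 1)) = n + 1) := ⟨by simp⟩
    exact Submodule.finrank_orthogonal_span_singleton hν
  have heq := Submodule.eq_of_le_of_finrank_eq hle (by
    rw [hfin]
    exact (LinearMap.finrank_range_of_inj (S.immersion x hx)).trans (by simp))
  have : y ∈ (ℝ ∙ ν)ᗮ := by rwa [Submodule.mem_orthogonal_singleton_iff_inner_left]
  rwa [← heq] at this

lemma eq_smul_N (hx : x ∈ Disk n) {ν : Euc (n + 1)} (hperp : ∀ v, ⟪S.dX x v, ν⟫ = 0) :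
    ν = ⟪ν, S.N x⟫ • S.N x := by
  have hN : ⟪S.N x, S.N x⟫ = 1 := by simp [S.unitN x hx]
  have hN0 : S.N x ≠ 0 := by
    intro h; simp [h] at hN
  have h0 : ⟪ν - ⟪ν, S.N x⟫ • S.N x, S.N x⟫ = 0 := by
    rw [inner_sub_left, inner_smul_left, hN]; simp
  obtain ⟨v, hv⟩ := S.exists_dX_eq hx hN0 (S.perpN x hx) h0
  refine sub_eq_zero.1 (inner_self_eq_zero (𝕜 := ℝ).1 ?_)
  rw [inner_sub_right, inner_smul_right, h0, ← hv, hperp]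
  simp

/-- There is a linear projection along the normal at `x` onto the tangent space at `x`, read in
the parameter domain. -/
lemma exists_tangent_projection (hx : x ∈ Disk n) :
    ∃ P : Euc (n + 1) →L[ℝ] Euc n, (∀ w, P (S.dX x w) = w) ∧
      ∀ y, y = S.dX x (P y) + ⟪y, S.N x⟫ • S.N x := by
  have hN : ⟪S.N x, S.N x⟫ = 1 := by simp [S.unitN x hx]
  have hN0 : S.N x ≠ 0 := fun h => by simp [h] at hN
  obtain ⟨P₀, hP₀⟩ := LinearMap.exists_leftInverse_of_injective (S.dX x).toLinearMap
    (LinearMap.ker_eq_bot.2 (S.immersion x hx))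
  have hP₀' : ∀ w, P₀ (S.dX x w) = w := fun w => LinearMap.congr_fun hP₀ w
  refine ⟨(LinearMap.toContinuousLinearMap P₀).comp
    (ContinuousLinearMap.id ℝ _ - (innerSL ℝ (S.N x)).smulRight (S.N x)), fun w => ?_, fun y => ?_⟩
  · have : ⟪S.N x, S.dX x w⟫ = 0 := by rw [real_inner_comm]; exact S.perpN x hx w
    simp [this, hP₀']
  · have h0 : ⟪y - ⟪S.N x, y⟫ • S.N x, S.N x⟫ = 0 := by
      rw [inner_sub_left, inner_smul_left, hN, real_inner_comm]; simp
    obtain ⟨v, hv⟩ := S.exists_dX_eq hx hN0 (S.perpN x hx) h0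
    have hPy : P₀ (y - ⟪S.N x, y⟫ • S.N x) = v := by rw [← hv, hP₀']
    simp only [ContinuousLinearMap.comp_apply, sub_apply,
      ContinuousLinearMap.id_apply, ContinuousLinearMap.smulRight_apply, innerSL_apply_apply,
      LinearMap.coe_toContinuousLinearMap', hPy]
    rw [hv, real_inner_comm]
    abel

/-- A weakly convex hypersurface lies locally on one side of its tangent hyperplanes. -/
lemma eventually_inner_N_le (hconv : WeaklyConvex S) {k : Euc n} (hk : k ∈ ball (0 : Euc n) 1) :
    ∀ᶠ x in 𝓝 k, ⟪S.X x, S.N k⟫ ≤ ⟪S.X k, S.N k⟫ := by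
  have hkD : k ∈ Disk n := ball_subset_closedBall hk
  obtain ⟨P, hPA, hAP⟩ := S.exists_tangent_projection hkD
  set ν := S.N k with hν
  have hNN : ⟪ν, ν⟫ = 1 := by simp [hν, S.unitN k hkD]
  have hΦ : ContDiffAt ℝ 1 (fun x => P (S.X x)) k :=
    P.contDiff.contDiffAt.comp k ((S.smoothX.contDiffAt (disk_mem_nhds hk)).of_le
      (WithTop.coe_le_coe.2 le_top))
  have hΦ' : HasFDerivAt (fun x => P (S.X x))
      ((ContinuousLinearEquiv.refl ℝ (Euc n) : Euc n ≃L[ℝ] Euc n) : Euc n →L[ℝ] Euc n) k := by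
    convert! P.hasFDerivAt.comp k (S.hasFDerivAt_X hk) using 1
    ext1 w
    simp [hPA]
  have hs := hΦ.hasStrictFDerivAt' hΦ' one_ne_zero
  set Ψ := hΦ.localInverse hΦ' one_ne_zero
  have hΨk : Ψ (P (S.X k)) = k := hΦ.localInverse_apply_image hΦ' one_ne_zero
  have hΨd : ContDiffAt ℝ 1 Ψ (P (S.X k)) := hΦ.to_localInverse hΦ' one_ne_zero
  have hleft : ∀ᶠ x in 𝓝 k, Ψ (P (S.X x)) = x := hs.eventually_left_inverse
  have hright : ∀ᶠ u in 𝓝 (P (S.X k)), P (S.X (Ψ u)) = u := hs.eventually_right_inverse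
  have hΨc : Tendsto Ψ (𝓝 (P (S.X k))) (𝓝 k) := by
    simpa [ContinuousAt, hΨk] using hΨd.continuousAt
  have hpos : ∀ᶠ x in 𝓝 k, 0 < ⟪ν, S.N x⟫ := by
    have : Tendsto (fun x => ⟪ν, S.N x⟫) (𝓝 k) (𝓝 ⟪ν, S.N k⟫) :=
      tendsto_const_nhds.inner (S.hasFDerivAt_N hk).continuousAt
    exact this.eventually (lt_mem_nhds (by rw [← hν, hNN]; exact one_pos))
  obtain ⟨r, hr, hball⟩ := Metric.eventually_nhds_iff_ball.1
    (((hright.eventually_nhds.and (hΨd.eventually (by simp))).and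
      (hΨc.eventually (isOpen_ball.mem_nhds hk))).and (hΨc.eventually hpos))
  filter_upwards [hleft, hΦ.continuousAt.eventually (ball_mem_nhds _ hr)] with x hxl hxb
  set u₀ := P (S.X k)
  set w := P (S.X x) - u₀ with hw
  have hmem : ∀ t ∈ Icc (0 : ℝ) 1, u₀ + t • w ∈ ball u₀ r := fun t ht =>
    (convex_ball u₀ r).add_smul_sub_mem (mem_ball_self hr) hxb ht
  set F : ℝ → ℝ := fun t => ⟪S.X (Ψ (u₀ + t • w)), ν⟫ with hF
  set q : ℝ → ℝ := fun t =>
    -⟪S.dX k w, S.N (Ψ (u₀ + t • w))⟫ / ⟪ν, S.N (Ψ (u₀ + t • w))⟫ with hq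
  have hder : ∀ t ∈ Icc (0 : ℝ) 1, HasDerivAt F (q t) t ∧ ∃ q', HasDerivAt q q' t ∧ q' ≤ 0 := by
    intro t ht
    obtain ⟨⟨⟨hinv, hd⟩, hb⟩, ha⟩ := hball _ (hmem t ht)
    have hbD : Ψ (u₀ + t • w) ∈ Disk n := ball_subset_closedBall hb
    have hline : HasDerivAt (fun t : ℝ => u₀ + t • w) w t := by
      simpa using ((hasDerivAt_id t).smul_const w).const_add u₀
    obtain ⟨c', hc⟩ : ∃ c', HasDerivAt (fun t : ℝ => Ψ (u₀ + t • w)) c' t :=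
      ⟨_, (hd.differentiableAt one_ne_zero).hasFDerivAt.comp_hasDerivAt t hline⟩
    have hX := (S.hasFDerivAt_X hb).comp_hasDerivAt t hc
    have hN := (S.hasFDerivAt_N hb).comp_hasDerivAt t hc
    have hPw : P (S.dX (Ψ (u₀ + t • w)) c') = w :=
      (P.hasFDerivAt.comp_hasDerivAt t hX).unique
        (hline.congr_of_eventuallyEq (hline.continuousAt.eventually hinv))
    have hF' := hX.inner ℝ (hasDerivAt_const t ν)
    have hsplit := hAP (S.dX (Ψ (u₀ + t • w)) c')
    rw [hPw] at hsplit
    set φ := ⟪S.dX (Ψ (u₀ + t • w)) c', ν⟫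
    have h0 : ⟪S.dX k w, S.N (Ψ (u₀ + t • w))⟫ + φ * ⟪ν, S.N (Ψ (u₀ + t • w))⟫ = 0 := by
      have := S.perpN _ hbD c'
      rw [← dX, hsplit, inner_add_left, inner_smul_left] at this
      simpa using this
    have h1 : 0 ≤ ⟪S.dX k w, S.dN (Ψ (u₀ + t • w)) c'⟫
        + φ * ⟪ν, S.dN (Ψ (u₀ + t • w)) c'⟫ := by
      have := S.inner_dX_dN_nonneg hconv hbD c'
      rw [hsplit, inner_add_left, inner_smul_left] at this
      simpa using this
    have hφ : φ = q t := by
      rw [hq]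
      field_simp
      linarith
    refine ⟨?_, _, ((hasDerivAt_const t (S.dX k w)).inner ℝ hN).neg.div
      ((hasDerivAt_const t ν).inner ℝ hN) ha.ne', ?_⟩
    · rw [← hφ]
      simpa using hF'
    · refine div_nonpos_of_nonpos_of_nonneg ?_ (sq_nonneg _)
      have h2 := mul_nonneg ha.le h1
      simp only [inner_zero_left, add_zero, Function.comp_apply, Pi.neg_apply]
      linear_combination h2 + ⟪ν, S.dN (Ψ (u₀ + t • w)) c'⟫ * h0
  have hq0 : q 0 = 0 := by
    have : ⟪S.dX k w, ν⟫ = 0 := S.perpN k hkD w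
    simp [hq, hΨk, ← hν, this]
  have hqanti : AntitoneOn q (Icc 0 1) := by
    refine antitoneOn_of_deriv_nonpos (convex_Icc 0 1) (fun t ht => ?_) (fun t ht => ?_)
      (fun t ht => ?_)
    · obtain ⟨_, q', h, _⟩ := hder t ht
      exact h.continuousAt.continuousWithinAt
    · obtain ⟨_, q', h, _⟩ := hder t (interior_subset ht)
      exact h.differentiableAt.differentiableWithinAt
    · obtain ⟨_, q', h, h'⟩ := hder t (interior_subset ht)
      rwa [h.deriv]
  have hFanti : AntitoneOn F (Icc 0 1) := by
    refine antitoneOn_of_deriv_nonpos (convex_Icc 0 1)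
      (fun t ht => (hder t ht).1.continuousAt.continuousWithinAt)
      (fun t ht => (hder t (interior_subset ht)).1.differentiableAt.differentiableWithinAt)
      (fun t ht => ?_)
    rw [(hder t (interior_subset ht)).1.deriv, ← hq0]
    exact hqanti (left_mem_Icc.2 zero_le_one) (interior_subset ht) (interior_subset ht).1
  have := hFanti (left_mem_Icc.2 zero_le_one) (right_mem_Icc.2 zero_le_one) zero_le_one
  simpa [hF, hw, hxl, hΨk] using this

/-- If `M` touches from outside a level set of `⟪·, ν⟫ + ε ‖·‖ ^ 2` at a point where this function
increases in the direction of the normal, then `M` is strictly convex there. -/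
lemma posDef_of_isLocalMax (hconv : WeaklyConvex S) (hx : x ∈ ball (0 : Euc n) 1)
    {ν : Euc (n + 1)} {ε : ℝ} (hε : 0 < ε)
    (hmax : IsLocalMax (fun y => ⟪S.X y, ν⟫ + ε * ⟪S.X y, S.X y⟫) x)
    (hpos : 0 < ⟪ν + (2 * ε) • S.X x, S.N x⟫) : (sff S x).PosDef := by
  have hxD : x ∈ Disk n := ball_subset_closedBall hx
  have hcrit : ∀ w, ⟪S.dX x w, ν + (2 * ε) • S.X x⟫ = 0 := fun w => by
    have hX := S.hasFDerivAt_X hx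
    have h := hmax.hasFDerivAt_eq_zero
      ((hX.inner ℝ (hasFDerivAt_const ν x)).add ((hX.inner ℝ hX).const_mul ε))
    have := congrArg (fun L : Euc n →L[ℝ] ℝ => L w) h
    simp [fderivInnerCLM_apply] at this
    rw [inner_add_right, inner_smul_right]
    rw [real_inner_comm (S.dX x w) (S.X x)] at this
    linear_combination this
  set lam := ⟪ν + (2 * ε) • S.X x, S.N x⟫
  have hlam : ν + (2 * ε) • S.X x = lam • S.N x := S.eq_smul_N hxD hcrit
  refine Matrix.PosDef.of_dotProduct_mulVec_pos (hconv x hxD).isHermitian fun v hv => ?_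
  set w : Euc n := WithLp.toLp 2 v
  have hw : S.dX x w ≠ 0 := fun h => hv (by
    have : w = 0 := S.immersion x hxD (h.trans (map_zero _).symm)
    simpa [w] using this)
  have hq := S.sff_quadratic hxD w
  simp only [star_trivial]
  change 0 < w.ofLp ⬝ᵥ (sff S x).mulVec w.ofLp
  rw [hq]
  by_contra! hle
  have hline : ∀ t : ℝ, HasDerivAt (fun t : ℝ => x + t • w) w t := fun t => by
    simpa using ((hasDerivAt_id t).smul_const w).const_add x
  have hline0 : Tendsto (fun t : ℝ => x + t • w) (𝓝 0) (𝓝 x) := by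
    simpa using (hline 0).continuousAt.tendsto
  set φ : ℝ → ℝ := fun t =>
    ⟪S.X (x + t • w), ν⟫ + ε * ⟪S.X (x + t • w), S.X (x + t • w)⟫ with hφ
  have hφmax : IsLocalMax φ 0 := by
    have := hline0.eventually hmax
    simpa [IsLocalMax, IsMaxFilter, hφ] using this
  have hd1 : ∀ᶠ t in 𝓝 (0 : ℝ),
      HasDerivAt φ ⟪S.dX (x + t • w) w, ν + (2 * ε) • S.X (x + t • w)⟫ t := by
    filter_upwards [hline0.eventually (isOpen_ball.mem_nhds hx)] with t ht
    have hX := (S.hasFDerivAt_X ht).comp_hasDerivAt t (hline t)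
    convert! (hX.inner ℝ (hasDerivAt_const t ν)).add ((hX.inner ℝ hX).const_mul ε) using 1
    simp only [Function.comp_apply, inner_zero_right, zero_add, inner_add_right, inner_smul_right]
    rw [real_inner_comm (S.dX (x + t • w) w) (S.X (x + t • w))]
    ring
  have hd2 : HasDerivAt (fun t : ℝ => ⟪S.dX (x + t • w) w, ν + (2 * ε) • S.X (x + t • w)⟫)
      (lam * -⟪S.dX x w, S.dN x w⟫ + 2 * ε * ⟪S.dX x w, S.dX x w⟫) 0 := by
    have hX : HasDerivAt (fun t : ℝ => S.X (x + t • w)) (S.dX x w) 0 :=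
      HasFDerivAt.comp_hasDerivAt 0 (by simpa using S.hasFDerivAt_X hx) (hline 0)
    have hdX : HasDerivAt (fun t : ℝ => S.dX (x + t • w) w) (S.ddX x w w) 0 :=
      HasFDerivAt.comp_hasDerivAt (f := fun t : ℝ => x + t • w) (l := fun y => S.dX y w) 0
        (by simpa using (S.hasFDerivWithinAt_dX hxD w).hasFDerivAt (disk_mem_nhds hx)) (hline 0)
    convert! hdX.inner ℝ ((hX.const_smul (2 * ε)).const_add ν) using 1
    simp only [Pi.smul_apply, zero_smul, add_zero, hlam, inner_smul_right, S.inner_ddX_N hxD]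
    ring
  have hderiv : deriv φ =ᶠ[𝓝 0] fun t : ℝ => ⟪S.dX (x + t • w) w, ν + (2 * ε) • S.X (x + t • w)⟫ :=
    hd1.mono fun t ht => ht.deriv
  have hdd : 0 < deriv (deriv φ) 0 := by
    rw [hderiv.deriv_eq, hd2.deriv]
    have h1 : 0 < ⟪S.dX x w, S.dX x w⟫ := real_inner_self_pos.2 hw
    have h2 := mul_nonneg hpos.le (neg_nonneg.2 hle)
    positivity
  have hφmin : IsLocalMin φ 0 := isLocalMin_of_deriv_deriv_pos hdd hφmax.deriv_eq_zero
    hd1.self_of_nhds.continuousAt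
  have hconst : φ =ᶠ[𝓝 0] fun _ => φ 0 := by
    filter_upwards [hφmax, hφmin] with t h1 h2 using le_antisymm h1 h2
  have : deriv φ =ᶠ[𝓝 0] fun _ => 0 := by
    simpa using hconst.deriv
  rw [this.deriv_eq] at hdd
  simp at hdd

/-- If `M` has no strictly convex interior point, then its tangent hyperplanes all contain the
origin as soon as this holds along the boundary. -/
lemma inner_X_N_eq_zero (hconv : WeaklyConvex S)
    (hbdry : ∀ x ∈ DiskBdry n, ⟪S.N x, S.X x⟫ = 0)
    (hno : ∀ x ∈ ball (0 : Euc n) 1, ¬ (sff S x).PosDef) (hx : x ∈ Disk n) :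
    ⟪S.X x, S.N x⟫ = 0 := by
  by_contra hc
  set ν := S.N x
  set c := ⟪S.X x, ν⟫
  have hνν : ‖ν‖ = 1 := S.unitN x hx
  set K : Set (Euc n) := {y ∈ Disk n | S.N y = ν ∧ ⟪S.X y, ν⟫ = c} with hK
  have hfc : ContinuousOn (fun y => ⟪S.X y, ν⟫) (Disk n) :=
    S.continuousOn_X.inner continuousOn_const
  have hKball : K ⊆ ball 0 1 := by
    rintro y ⟨hy, hyN, hyc⟩
    by_contra hyb
    refine hc (hyc ▸ ?_)
    rw [← hyN, real_inner_comm]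
    exact hbdry y (mem_sphere.2 (le_antisymm hy (not_lt.1 hyb)))
  have hKclosed : IsClosed K := by
    have h := ((S.continuousOn_N.prodMk hfc).preimage_isClosed_of_isClosed
      (isCompact_disk.isClosed) (isClosed_singleton (x := (ν, c))))
    convert! h using 1
    ext y
    simp only [hK, mem_ofPred_eq, mem_inter_iff, mem_preimage, mem_singleton_iff, Prod.mk.injEq]
  have hKcomp : IsCompact K := isCompact_disk.of_isClosed_subset hKclosed fun y hy => hy.1
  set W : Set (Euc n) := interior {y | y ∈ ball (0 : Euc n) 1 ∧ ⟪S.X y, ν⟫ ≤ c ∧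
    1 / 2 < ⟪ν, S.N y⟫}
  have hKW : K ⊆ W := fun k hk => by
    have hkb := hKball hk
    refine mem_interior_iff_mem_nhds.2 ?_
    have h1 := S.eventually_inner_N_le hconv hkb
    rw [hk.2.1, hk.2.2] at h1
    have h2 : Tendsto (fun y => ⟪ν, S.N y⟫) (𝓝 k) (𝓝 ⟪ν, S.N k⟫) :=
      tendsto_const_nhds.inner (S.hasFDerivAt_N hkb).continuousAt
    rw [hk.2.1, real_inner_self_eq_norm_sq, hνν] at h2
    filter_upwards [isOpen_ball.mem_nhds hkb, h1,
      h2.eventually (lt_mem_nhds (by norm_num : (1 / 2 : ℝ) < 1 ^ 2))] with y h h' h'' using ⟨h, h', h''⟩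
  have hWK : ∀ y ∈ W, ⟪S.X y, ν⟫ = c → y ∈ K := by
    intro y hy hyc
    obtain ⟨hyb, -, hyN⟩ := interior_subset hy
    have hyD : y ∈ Disk n := ball_subset_closedBall hyb
    have hmax : IsLocalMax (fun z => ⟪S.X z, ν⟫) y := by
      filter_upwards [isOpen_interior.mem_nhds hy] with z hz
      rw [hyc]
      exact (interior_subset hz).2.1
    have hcrit : ∀ w, ⟪S.dX y w, ν⟫ = 0 := fun w => by
      have h := hmax.hasFDerivAt_eq_zero
        ((S.hasFDerivAt_X hyb).inner ℝ (hasFDerivAt_const ν y))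
      simpa [fderivInnerCLM_apply] using congrArg (fun L : Euc n →L[ℝ] ℝ => L w) h
    have hνN := S.eq_smul_N hyD hcrit
    have h1 : ⟪ν, S.N y⟫ = 1 := by
      have := congrArg norm hνN
      rw [norm_smul, S.unitN y hyD, hνν, mul_one, Real.norm_of_nonneg (by linarith)] at this
      exact this.symm
    rw [h1, one_smul] at hνN
    exact ⟨hyD, hνN.symm, hyc⟩
  obtain ⟨U, hUcomp, hKU, hUW⟩ := exists_compact_between hKcomp isOpen_interior hKW
  have hxK : x ∈ K := ⟨hx, rfl, rfl⟩
  have hUD : U ⊆ Disk n := fun y hy => ball_subset_closedBall (interior_subset (hUW hy)).1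
  obtain ⟨δ, hδ, hδU⟩ : ∃ δ > 0, ∀ y ∈ U \ interior U, ⟪S.X y, ν⟫ ≤ c - δ := by
    rcases (U \ interior U).eq_empty_or_nonempty with he | hne
    · exact ⟨1, one_pos, by simp [he]⟩
    obtain ⟨z, hz, hzmax⟩ := (hUcomp.diff isOpen_interior).exists_isMaxOn hne
      (hfc.mono (sdiff_subset.trans hUD))
    refine ⟨c - ⟪S.X z, ν⟫, sub_pos.2 (lt_of_le_of_ne (interior_subset (hUW hz.1)).2.1 fun h => ?_),
      fun y hy => by simpa using hzmax hy⟩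
    exact hz.2 (hKU (hWK z (hUW hz.1) h))
  obtain ⟨R, hR⟩ := isCompact_disk.exists_bound_of_continuousOn S.continuousOn_X
  have hR0 : 0 ≤ R := (norm_nonneg _).trans (hR x hx)
  obtain ⟨ε, hε, hεδ, hεR⟩ : ∃ ε > 0, ε * R ^ 2 < δ ∧ 2 * ε * R < 1 / 2 := by
    have h1 : Tendsto (fun ε : ℝ => ε * R ^ 2) (𝓝[>] 0) (𝓝 0) :=
      tendsto_nhdsWithin_of_tendsto_nhds (Continuous.tendsto' (by fun_prop) _ _ (by simp))
    have h2 : Tendsto (fun ε : ℝ => 2 * ε * R) (𝓝[>] 0) (𝓝 0) :=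
      tendsto_nhdsWithin_of_tendsto_nhds (Continuous.tendsto' (by fun_prop) _ _ (by simp))
    obtain ⟨ε, h, h'⟩ := (eventually_mem_nhdsWithin.and ((h1.eventually (gt_mem_nhds hδ)).and
      (h2.eventually (gt_mem_nhds (by norm_num : (0 : ℝ) < 1 / 2))))).exists
    exact ⟨ε, h, h'⟩
  obtain ⟨z, hzU, hzmax⟩ := hUcomp.exists_isMaxOn ⟨x, interior_subset (hKU hxK)⟩
    ((hfc.add (continuousOn_const (c := ε) |>.mul
      (S.continuousOn_X.inner S.continuousOn_X))).mono hUD)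
  have hzint : z ∈ interior U := by
    by_contra hz
    have h1 := hδU z ⟨hzU, hz⟩
    have h2 : c + ε * ⟪S.X x, S.X x⟫ ≤ ⟪S.X z, ν⟫ + ε * ⟪S.X z, S.X z⟫ :=
      hzmax (interior_subset (hKU hxK))
    have h3 : ⟪S.X z, S.X z⟫ ≤ R ^ 2 := by
      rw [real_inner_self_eq_norm_sq]
      exact pow_le_pow_left₀ (norm_nonneg _) (hR z (hUD hzU)) 2
    have h4 := mul_le_mul_of_nonneg_left h3 hε.le
    have h5 := mul_nonneg hε.le (real_inner_self_nonneg (x := S.X x))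
    linarith
  obtain ⟨hzb, -, hzN⟩ := interior_subset (hUW hzU)
  refine hno z hzb (S.posDef_of_isLocalMax hconv hzb hε
    (hzmax.isLocalMax (mem_interior_iff_mem_nhds.1 hzint)) ?_)
  rw [inner_add_left, inner_smul_left]
  have h6 : |⟪S.X z, S.N z⟫| ≤ R := by
    have := abs_real_inner_le_norm (S.X z) (S.N z)
    rw [S.unitN z (hUD hzU), mul_one] at this
    exact this.trans (hR z (hUD hzU))
  have h7 := mul_le_mul_of_nonneg_left (abs_le.1 h6).1 (by positivity : 0 ≤ 2 * ε)
  simp only [conj_trivial]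
  linarith

lemma norm_eq_one_of_mem_diskBdry (hx : x ∈ DiskBdry n) : ‖x‖ = 1 := by
  simpa [DiskBdry] using hx

lemma diskBdry_subset_disk : DiskBdry n ⊆ Disk n := sphere_subset_closedBall

lemma exists_add_smul_mem_disk (hx : x ∈ DiskBdry n) {u : Euc n} (hu : ⟪x, u⟫ < 0) :
    ∃ ε > 0, ∀ t ∈ Icc (0 : ℝ) ε, x + t • u ∈ Disk n := by
  have hx1 : ‖x‖ = 1 := norm_eq_one_of_mem_diskBdry hx
  refine ⟨-2 * ⟪x, u⟫ / (‖u‖ ^ 2 + 1), by apply div_pos <;> [linarith; positivity],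
    fun t ht => ?_⟩
  have h1 : t * (‖u‖ ^ 2 + 1) ≤ -2 * ⟪x, u⟫ := (le_div_iff₀ (by positivity)).1 ht.2
  have h2 : ‖x + t • u‖ ^ 2 ≤ 1 := by
    rw [norm_add_sq_real, inner_smul_right, norm_smul, hx1, mul_pow, Real.norm_eq_abs, sq_abs]
    nlinarith [mul_le_mul_of_nonneg_left h1 ht.1, mul_nonneg ht.1 ht.1]
  rw [Disk, mem_closedBall_zero_iff]
  exact (sq_le_one_iff₀ (norm_nonneg _)).1 h2

lemma mem_posTangentConeAt_disk (hx : x ∈ ball (0 : Euc n) 1) (u : Euc n) :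
    u ∈ posTangentConeAt (Disk n) x := by
  refine mem_posTangentConeAt_of_frequently_mem (Eventually.frequently ?_)
  have h : Tendsto (fun t : ℝ => x + t • u) (𝓝[>] 0) (𝓝 x) :=
    tendsto_nhdsWithin_of_tendsto_nhds (Continuous.tendsto' (by fun_prop) _ _ (by simp))
  exact h.eventually (disk_mem_nhds hx)

lemma mem_posTangentConeAt_disk_of_inner_neg (hx : x ∈ DiskBdry n) {u : Euc n}
    (hu : ⟪x, u⟫ < 0) : u ∈ posTangentConeAt (Disk n) x := by
  obtain ⟨ε, hε, h⟩ := exists_add_smul_mem_disk hx hu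
  refine mem_posTangentConeAt_of_frequently_mem (Eventually.frequently ?_)
  filter_upwards [Ioc_mem_nhdsGT hε] with t ht using h t ⟨ht.1.le, ht.2⟩

/-- A vector tangent to the unit sphere is the velocity of a curve in the sphere. -/
lemma exists_curve_diskBdry (hx : x ∈ DiskBdry n) {τ : Euc n} (hτ : ⟪x, τ⟫ = 0) :
    ∃ c : ℝ → Euc n, c 0 = x ∧ (∀ t, c t ∈ DiskBdry n) ∧ HasDerivAt c τ 0 := by
  have hx1 : ‖x‖ = 1 := norm_eq_one_of_mem_diskBdry hx
  have hpos : ∀ t : ℝ, 0 < 1 + t ^ 2 * ‖τ‖ ^ 2 := fun t => by positivity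
  refine ⟨fun t => (√(1 + t ^ 2 * ‖τ‖ ^ 2))⁻¹ • (x + t • τ), by simp, fun t => ?_, ?_⟩
  · have h : ‖x + t • τ‖ = √(1 + t ^ 2 * ‖τ‖ ^ 2) := by
      rw [← Real.sqrt_sq (norm_nonneg (x + t • τ)), norm_add_sq_real, inner_smul_right, hτ,
        norm_smul, hx1, mul_pow, Real.norm_eq_abs, sq_abs]
      simp
    rw [DiskBdry, mem_sphere_zero_iff_norm, norm_smul, h, norm_inv,
      Real.norm_of_nonneg (Real.sqrt_nonneg _)]
    exact inv_mul_cancel₀ (Real.sqrt_pos.2 (hpos t)).ne'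
  · have h1 : HasDerivAt (fun t : ℝ => 1 + t ^ 2 * ‖τ‖ ^ 2) 0 0 := by
      simpa using (((hasDerivAt_id (0 : ℝ)).pow 2).mul_const (‖τ‖ ^ 2)).const_add 1
    have h2 : HasDerivAt (fun t : ℝ => (√(1 + t ^ 2 * ‖τ‖ ^ 2))⁻¹) 0 0 := by
      convert! (h1.sqrt (hpos 0).ne').fun_inv (Real.sqrt_pos.2 (hpos 0)).ne' using 1
      simp
    have h3 : HasDerivAt (fun t : ℝ => x + t • τ) τ 0 := by
      simpa using ((hasDerivAt_id (0 : ℝ)).smul_const τ).const_add x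
    convert! h2.smul h3 using 1
    simp

lemma hasDerivAt_X_comp {c : ℝ → Euc n} {τ : Euc n} (hc0 : c 0 = x)
    (hc : ∀ t, c t ∈ DiskBdry n) (hc' : HasDerivAt c τ 0) :
    HasDerivAt (fun t => S.X (c t)) (S.dX x τ) 0 := by
  subst hc0
  exact (S.hasFDerivWithinAt_X (diskBdry_subset_disk (hc 0))).comp_hasDerivAt 0 hc'
    (Eventually.of_forall fun t => diskBdry_subset_disk (hc t))

lemma inner_dX_X_eq_zero (hperp : PerpFromInside S) (hx : x ∈ DiskBdry n) {τ : Euc n}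
    (hτ : ⟪x, τ⟫ = 0) : ⟪S.dX x τ, S.X x⟫ = 0 := by
  obtain ⟨c, hc0, hc, hc'⟩ := exists_curve_diskBdry hx hτ
  have hX := S.hasDerivAt_X_comp hc0 hc hc'
  have h1 := hX.inner ℝ hX
  have h2 : (fun t => ⟪S.X (c t), S.X (c t)⟫) = fun _ => (1 : ℝ) := by
    funext t
    have := hperp.1 (c t) (hc t)
    rw [mem_sphere_zero_iff_norm] at this
    simp [this]
  rw [h2] at h1
  have h3 := (hasDerivAt_const (0 : ℝ) (1 : ℝ)).unique h1
  rw [hc0, real_inner_comm (S.dX x τ) (S.X x)] at h3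
  linarith

/-- At the boundary, the position vector is the image of an outward pointing vector. -/
lemma exists_outward (hperp : PerpFromInside S) (hx : x ∈ DiskBdry n) :
    ∃ V, S.dX x V = S.X x ∧ 0 < ⟪x, V⟫ := by
  have hxD := diskBdry_subset_disk hx
  have hX1 : ⟪S.X x, S.X x⟫ = 1 := by
    have := hperp.1 x hx
    rw [mem_sphere_zero_iff_norm] at this
    simp [this]
  have hN0 : S.N x ≠ 0 := norm_ne_zero_iff.1 (by simp [S.unitN x hxD])
  obtain ⟨V, hV⟩ := S.exists_dX_eq hxD hN0 (S.perpN x hxD)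
    (by rw [real_inner_comm]; exact hperp.2.1 x hx)
  refine ⟨V, hV, ?_⟩
  rcases lt_trichotomy ⟪x, V⟫ 0 with h | h | h
  · obtain ⟨ε, hε, hmem⟩ := exists_add_smul_mem_disk hx h
    have hmaps : MapsTo (fun t : ℝ => x + (-t) • V) (Icc (-ε) 0) (Disk n) := fun t ht =>
      hmem (-t) ⟨by linarith [ht.2], by linarith [ht.1]⟩
    have hline : HasDerivAt (fun t : ℝ => x + (-t) • V) (-V) 0 := by
      simpa using ((hasDerivAt_id (0 : ℝ)).neg.smul_const V).const_add x
    have hsmooth : ContDiffOn ℝ 1 (fun t : ℝ => S.X (x + (-t) • V)) (Icc (-ε) 0) :=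
      (S.smoothX.of_le (WithTop.coe_le_coe.2 le_top)).comp
        (ContDiff.contDiffOn (by fun_prop)) hmaps
    have hd : HasDerivWithinAt (fun t : ℝ => S.X (x + (-t) • V)) (-S.X x) (Icc (-ε) 0) 0 := by
      rw [← hV, ← map_neg]
      refine HasFDerivWithinAt.comp_hasDerivWithinAt (f := fun t : ℝ => x + (-t) • V) 0 ?_
        hline.hasDerivWithinAt hmaps
      simpa using S.hasFDerivWithinAt_X hxD
    have := hperp.2.2 _ ε hε hsmooth (fun t ht => ⟨_, hmaps ht, rfl⟩)
      ⟨x, hx, by simp⟩ _ hd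
    simp only [neg_zero, zero_smul, add_zero, inner_neg_left, hX1] at this
    linarith
  · have := S.inner_dX_X_eq_zero hperp hx h
    rw [hV, hX1] at this
    exact absurd this one_ne_zero
  · exact h

lemma mem_ball_or_mem_diskBdry (hx : x ∈ Disk n) : x ∈ ball (0 : Euc n) 1 ∨ x ∈ DiskBdry n := by
  rw [← mem_union, DiskBdry, ball_union_sphere]
  exact hx

/-- If all tangent hyperplanes contain the origin, then the position vector is the image of a
vector whose opposite points into the disk. -/
lemma exists_radial (hperp : PerpFromInside S) (hx : x ∈ Disk n) (hXN : ⟪S.X x, S.N x⟫ = 0) :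
    ∃ V, S.dX x V = S.X x ∧ -V ∈ posTangentConeAt (Disk n) x := by
  rcases mem_ball_or_mem_diskBdry hx with hxb | hxb
  · have hN0 : S.N x ≠ 0 := norm_ne_zero_iff.1 (by simp [S.unitN x hx])
    obtain ⟨V, hV⟩ := S.exists_dX_eq hx hN0 (S.perpN x hx) hXN
    exact ⟨V, hV, mem_posTangentConeAt_disk hxb _⟩
  · obtain ⟨V, hV, h⟩ := S.exists_outward hperp hxb
    exact ⟨V, hV, mem_posTangentConeAt_disk_of_inner_neg hxb (by simpa using h)⟩

lemma exists_X_eq_zero (hperp : PerpFromInside S)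
    (hXN : ∀ x ∈ Disk n, ⟪S.X x, S.N x⟫ = 0) : ∃ x ∈ ball (0 : Euc n) 1, S.X x = 0 := by
  obtain ⟨x, hx, hmin⟩ := isCompact_disk.exists_isMinOn
    (⟨0, mem_closedBall_self zero_le_one⟩ : (Disk n).Nonempty)
    (S.continuousOn_X.inner (𝕜 := ℝ) S.continuousOn_X)
  obtain ⟨V, hV, hcone⟩ := S.exists_radial hperp hx (hXN x hx)
  have hX := S.hasFDerivWithinAt_X hx
  have h := hmin.localize.hasFDerivWithinAt_nonneg (hX.inner ℝ hX) hcone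
  have hX0 : S.X x = 0 := by
    simpa [fderivInnerCLM_apply, hV] using h
  refine ⟨x, (mem_ball_or_mem_diskBdry hx).resolve_right fun hb => ?_, hX0⟩
  have := hperp.1 x hb
  simp [hX0] at this

/-- If all tangent hyperplanes contain the origin, then `M` is a cone which is smooth at its
vertex, hence it is contained in a hyperplane. -/
lemma inner_X_N_vertex_eq_zero (hperp : PerpFromInside S)
    (hXN : ∀ x ∈ Disk n, ⟪S.X x, S.N x⟫ = 0) {o : Euc n} (ho : o ∈ ball (0 : Euc n) 1)
    (hXo : S.X o = 0) (hx : x ∈ Disk n) : ⟪S.X x, S.N o⟫ = 0 := by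
  have hoD : o ∈ Disk n := ball_subset_closedBall ho
  by_contra hne
  have hXne : ∀ y ∈ Disk n, y ≠ o → S.X y ≠ 0 := fun y hy hyo h =>
    hyo (S.injX hy hoD (h.trans hXo.symm))
  set f : Euc n → ℝ := fun y => ⟪S.X y, S.N o⟫ with hf
  set s : Euc n → ℝ := fun y => ⟪S.X y, S.X y⟫ with hs
  have hspos : ∀ y ∈ Disk n, y ≠ o → 0 < s y := fun y hy hyo =>
    real_inner_self_pos.2 (hXne y hy hyo)
  have hxo : x ≠ o := fun h => hne (by simp [h, hXo])
  have hfd : ∀ y ∈ Disk n, HasFDerivWithinAt f _ (Disk n) y := fun y hy =>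
    (S.hasFDerivWithinAt_X hy).inner ℝ (hasFDerivWithinAt_const (S.N o) y (Disk n))
  have hsd : ∀ y ∈ Disk n, HasFDerivWithinAt s _ (Disk n) y := fun y hy =>
    (S.hasFDerivWithinAt_X hy).inner ℝ (S.hasFDerivWithinAt_X hy)
  have hfc : ContinuousOn f (Disk n) := fun y hy => (hfd y hy).continuousWithinAt
  have hsc : ContinuousOn s (Disk n) := fun y hy => (hsd y hy).continuousWithinAt
  have hratio : ContinuousOn (fun y => f y ^ 2 / s y) (Disk n) := by
    intro y hy
    by_cases hyo : y = o
    · subst hyo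
      have h1 : f =o[𝓝 y] fun z => z - y := by
        have h := ((S.hasFDerivAt_X ho).inner ℝ (hasFDerivAt_const (S.N y) y)).isLittleO
        refine h.congr_left fun z => ?_
        have : ⟪S.dX y (z - y), S.N y⟫ = 0 := S.perpN y hy _
        rw [map_sub] at this
        simp [fderivInnerCLM_apply, hXo, hf, this]
      have h2 : (fun z => z - y) =O[𝓝 y] S.X := by
        have hind : Topology.IsInducing (S.dX y) :=
          (LinearMap.isClosedEmbedding_of_injective (f := (S.dX y).toLinearMap)
            (LinearMap.ker_eq_bot.2 (S.immersion y hy))).isInducing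
        simpa [hXo] using ((S.hasFDerivAt_X ho).isTheta_sub hind).isBigO_symm
      have h3 : Tendsto (fun z => (f z / ‖S.X z‖) ^ 2) (𝓝 y) (𝓝 (0 ^ 2)) :=
        ((h1.trans_isBigO h2).norm_right.tendsto_div_nhds_zero).pow 2
      have h4 : (fun z => f z ^ 2 / s z) = fun z => (f z / ‖S.X z‖) ^ 2 := by
        funext z
        simp [hs, div_pow]
      rw [h4]
      refine ContinuousAt.continuousWithinAt ?_
      simpa [ContinuousAt, hXo] using h3
    · exact ((hfc y hy).pow 2).div (hsc y hy) (hspos y hy hyo).ne'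
  set δ := f x ^ 2 / (2 * s x ^ 2) with hδ
  have hsx := hspos x hx hxo
  have hfx : 0 < f x ^ 2 := by positivity
  have hδ0 : 0 < δ := by positivity
  obtain ⟨z, hz, hzmax⟩ := isCompact_disk.exists_isMaxOn ⟨x, hx⟩
    (hratio.sub (hsc.const_smul δ))
  set m := f z ^ 2 / s z - δ * s z with hm
  have hmax : ∀ y ∈ Disk n, f y ^ 2 / s y - δ * s y ≤ m := fun y hy => hzmax hy
  have hm0 : 0 < m := by
    refine lt_of_lt_of_le ?_ (hmax x hx)
    have : f x ^ 2 / s x - δ * s x = f x ^ 2 / s x / 2 := by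
      rw [hδ]; field_simp; ring
    rw [this]
    positivity
  have hzo : z ≠ o := by
    rintro rfl
    simp [hm, hf, hs, hXo] at hm0
  have hsz := hspos z hz hzo
  have hmz : f z ^ 2 = m * s z + δ * s z ^ 2 := by
    rw [hm]; field_simp; ring
  have hGmax : IsMaxOn (fun y => f y * f y - m * s y - δ * (s y * s y)) (Disk n) z := by
    intro y hy
    change f y * f y - m * s y - δ * (s y * s y) ≤ f z * f z - m * s z - δ * (s z * s z)
    have h0 : f z * f z - m * s z - δ * (s z * s z) = 0 := by linear_combination hmz
    rw [h0]
    by_cases hyo : y = o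
    · simp [hyo, hf, hs, hXo]
    · have hsy := hspos y hy hyo
      have := hmax y hy
      rw [sub_le_iff_le_add, div_le_iff₀ hsy] at this
      linarith
  obtain ⟨V, hV, hcone⟩ := S.exists_radial hperp hz (hXN z hz)
  have h := hGmax.localize.hasFDerivWithinAt_nonpos
    ((((hfd z hz).mul (hfd z hz)).sub ((hsd z hz).const_mul m)).sub
      (((hsd z hz).mul (hsd z hz)).const_mul δ)) hcone
  simp [hV] at h
  have hs2 : ‖S.X z‖ ^ 2 = s z := (real_inner_self_eq_norm_sq _).symm
  have hf2 : ⟪S.X z, S.N o⟫ = f z := rfl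
  rw [hs2, hf2] at h
  have : 0 < δ * s z ^ 2 := by positivity
  nlinarith

/-- A hypersurface disk perpendicular to the sphere and contained in a hyperplane through the
origin bounds an equator. -/
lemma image_diskBdry_eq (hperp : PerpFromInside S) {ν : Euc (n + 1)} (hν : ν ≠ 0)
    (hflat : ∀ x ∈ Disk n, ⟪S.X x, ν⟫ = 0) {o : Euc n} (ho : o ∈ Disk n) (hXo : S.X o = 0) :
    S.X '' DiskBdry n = {y ∈ sphere (0 : Euc (n + 1)) 1 | ⟪y, ν⟫ = 0} := by
  refine Subset.antisymm ?_ ?_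
  · rintro _ ⟨x, hx, rfl⟩
    exact ⟨hperp.1 x hx, hflat x (diskBdry_subset_disk hx)⟩
  rintro e ⟨he, heν⟩
  rw [mem_sphere_zero_iff_norm] at he
  have hee : ⟪e, e⟫ = 1 := by simp [he]
  obtain ⟨x, hx, hmax⟩ := isCompact_disk.exists_isMaxOn ⟨o, ho⟩
    (S.continuousOn_X.inner (𝕜 := ℝ) (continuousOn_const (c := e)))
  have hdν : ∀ v, ⟪S.dX x v, ν⟫ = 0 := fun v => by
    have h1 := (S.hasFDerivWithinAt_X hx).inner ℝ (hasFDerivWithinAt_const ν x (Disk n))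
    have h2 : HasFDerivWithinAt (fun y => ⟪S.X y, ν⟫) (0 : Euc n →L[ℝ] ℝ) (Disk n) x :=
      (hasFDerivWithinAt_const (0 : ℝ) x _).congr hflat (hflat x hx)
    simpa [fderivInnerCLM_apply] using
      congrArg (fun L : Euc n →L[ℝ] ℝ => L v) ((uniqueDiffOn_disk x hx).eq h1 h2)
  obtain ⟨w, hw⟩ := S.exists_dX_eq hx hν hdν heν
  rcases mem_ball_or_mem_diskBdry hx with hxb | hxb
  · have h := hmax.localize.hasFDerivWithinAt_nonpos
      ((S.hasFDerivWithinAt_X hx).inner ℝ (hasFDerivWithinAt_const e x (Disk n)))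
      (mem_posTangentConeAt_disk hxb w)
    simp [fderivInnerCLM_apply, hw, he] at h
    linarith
  obtain ⟨V, hV, hxV⟩ := S.exists_outward hperp hxb
  have hX1 : ‖S.X x‖ = 1 := mem_sphere_zero_iff_norm.1 (hperp.1 x hxb)
  have hτ : ⟪x, w - (⟪x, w⟫ / ⟪x, V⟫) • V⟫ = 0 := by
    rw [inner_sub_right, inner_smul_right]
    field_simp
    ring
  set α := ⟪x, w⟫ / ⟪x, V⟫
  have h1 : ⟪e - α • S.X x, S.X x⟫ = 0 := by
    simpa [hw, hV] using S.inner_dX_X_eq_zero hperp hxb hτ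
  have h2 : ⟪e - α • S.X x, e⟫ = 0 := by
    obtain ⟨c, hc0, hc, hc'⟩ := exists_curve_diskBdry hxb hτ
    have hlocal : IsLocalMax (fun t => ⟪S.X (c t), e⟫) 0 :=
      Eventually.of_forall fun t => by simpa [hc0] using hmax (diskBdry_subset_disk (hc t))
    simpa [hw, hV] using hlocal.hasDerivAt_eq_zero
      ((S.hasDerivAt_X_comp hc0 hc hc').inner ℝ (hasDerivAt_const 0 e))
  have h3 : 0 ≤ ⟪S.X x, e⟫ := by simpa [hXo] using hmax ho
  rw [inner_sub_left, inner_smul_left] at h1 h2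
  have hXX : ⟪S.X x, S.X x⟫ = 1 := by simp [hX1]
  rw [hXX, real_inner_comm] at h1
  rw [hee] at h2
  simp only [conj_trivial, mul_one] at h1 h2
  have h4 : ⟪S.X x, e⟫ = 1 := by nlinarith
  exact ⟨x, hxb, (inner_eq_one_iff_of_norm_eq_one hX1 he).1 h4⟩

end HypDisk

/-- If `M ⊂ ℝ^{n+1}` is a smooth, weakly convex embedded `n`-disk perpendicular to
`S^n` from the inside, then either `∂M` is an equator of `S^n`, or there is an interior point
`x ∈ int(𝔻)` at which the second fundamental form of `M` is positive definite. -/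
theorem equator_or_strictly_convex_point (n : ℕ) (S : HypDisk n)
    (hconv : WeaklyConvex S) (hperp : PerpFromInside S) :
    IsEquator (S.X '' DiskBdry n) ∨
      ∃ x ∈ Metric.ball (0 : Euc n) 1, (sff S x).PosDef := by
  by_contra! h
  obtain ⟨heq, hno⟩ := h
  have hXN : ∀ x ∈ Disk n, ⟪S.X x, S.N x⟫ = 0 := fun x hx =>
    S.inner_X_N_eq_zero hconv hperp.2.1 hno hx
  obtain ⟨o, ho, hXo⟩ := S.exists_X_eq_zero hperp hXN
  have hoD : o ∈ Disk n := ball_subset_closedBall ho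
  have hν : S.N o ≠ 0 := norm_ne_zero_iff.1 (by simp [S.unitN o hoD])
  exact heq ⟨S.N o, hν, S.image_diskBdry_eq hperp hν
    (fun x hx => S.inner_X_N_vertex_eq_zero hperp hXN ho hXo hx) hoD hXo⟩

end
end

section
/- Suppose M is a weakly convex hypersurface (smoothly embedded n-disk) perpendicular to S^n from the inside such that ∂M is not an equator. Then there exists ε > 0 and a family (M_t)_{0 < t < ε} of smooth, strictly convex hypersurfaces perpendicular to S^n from the inside such that ∫_{M_t} H² dμ_t → ∫_M H² dμ, |M_t| → |M|, and |∂M_t| → |∂M| as t → 0. -/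
open Metric Set MeasureTheory Filter
open scoped RealInnerProductSpace ENNReal NNReal

noncomputable section

variable {n : ℕ}

/-- Derivative within the closed disk. -/
local notation "𝒟[" f "]" => fderivWithin ℝ f (Disk _)

section DiskCalculus

variable {F : Type*} [NormedAddCommGroup F] [NormedSpace ℝ F]
  {V : Type*} [NormedAddCommGroup V] [InnerProductSpace ℝ V]

lemma convex_disk : Convex ℝ (Disk n) := convex_closedBall 0 1

lemma isCompact_disk : IsCompact (Disk n) := isCompact_closedBall 0 1

lemma zero_mem_disk : (0 : Euc n) ∈ Disk n := by simp [Disk]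

lemma diskBdry_subset_disk : DiskBdry n ⊆ Disk n := sphere_subset_closedBall

lemma interior_disk_nonempty : (interior (Disk n)).Nonempty :=
  ⟨0, mem_interior_iff_mem_nhds.2 (closedBall_mem_nhds 0 one_pos)⟩

lemma uniqueDiffOn_disk : UniqueDiffOn ℝ (Disk n) :=
  uniqueDiffOn_convex convex_disk interior_disk_nonempty

lemma mem_closure_interior_disk {x : Euc n} (hx : x ∈ Disk n) :
    x ∈ closure (interior (Disk n)) := by
  rw [convex_disk.closure_interior_eq_closure_of_nonempty_interior interior_disk_nonempty]
  exact subset_closure hx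

lemma ContDiffOn.diskDeriv {f : Euc n → F} (hf : ContDiffOn ℝ (⊤ : ℕ∞) f (Disk n)) :
    ContDiffOn ℝ (⊤ : ℕ∞) 𝒟[f] (Disk n) :=
  hf.fderivWithin uniqueDiffOn_disk (by norm_cast)

lemma ContDiffOn.diffWithinAt_disk {f : Euc n → F} (hf : ContDiffOn ℝ (⊤ : ℕ∞) f (Disk n))
    {x : Euc n} (hx : x ∈ Disk n) : DifferentiableWithinAt ℝ f (Disk n) x :=
  (hf.differentiableOn (by simp)) x hx

lemma diskDeriv_inner {f g : Euc n → V} (hf : ContDiffOn ℝ (⊤ : ℕ∞) f (Disk n))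
    (hg : ContDiffOn ℝ (⊤ : ℕ∞) g (Disk n)) {x : Euc n} (hx : x ∈ Disk n) (w : Euc n) :
    𝒟[fun y => ⟪f y, g y⟫] x w = ⟪f x, 𝒟[g] x w⟫ + ⟪𝒟[f] x w, g x⟫ :=
  by
  have h := (hf.diffWithinAt_disk hx).hasFDerivWithinAt.inner ℝ
    (hg.diffWithinAt_disk hx).hasFDerivWithinAt
  rw [h.fderivWithin (uniqueDiffOn_disk x hx)]
  simp

lemma diskDeriv_deriv_apply {f : Euc n → F} (hf : ContDiffOn ℝ (⊤ : ℕ∞) f (Disk n))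
    {x : Euc n} (hx : x ∈ Disk n) (v w : Euc n) :
    𝒟[fun y => 𝒟[f] y w] x v = 𝒟[𝒟[f]] x v w := by
  have h := fderivWithin_clm_apply (u := fun _ : Euc n => w) (uniqueDiffOn_disk x hx)
    (hf.diskDeriv.diffWithinAt_disk hx) (differentiableWithinAt_const w)
  rw [h]
  simp

lemma contDiffOn_deriv_apply {f : Euc n → F} (hf : ContDiffOn ℝ (⊤ : ℕ∞) f (Disk n))
    (w : Euc n) : ContDiffOn ℝ (⊤ : ℕ∞) (fun y => 𝒟[f] y w) (Disk n) :=
  hf.diskDeriv.clm_apply contDiffOn_const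

lemma diskDeriv_deriv_symm {f : Euc n → F} (hf : ContDiffOn ℝ (⊤ : ℕ∞) f (Disk n))
    {x : Euc n} (hx : x ∈ Disk n) (v w : Euc n) :
    𝒟[𝒟[f]] x v w = 𝒟[𝒟[f]] x w v :=
  ((hf x hx).isSymmSndFDerivWithinAt (by simp; norm_cast) uniqueDiffOn_disk
    (mem_closure_interior_disk hx) hx).eq v w

/-- Smooth maps on the disk have bounded values. -/
lemma ContinuousOn.exists_bound_disk {G : Type*} [SeminormedAddCommGroup G] {f : Euc n → G}
    (hf : ContinuousOn f (Disk n)) : ∃ C, 0 ≤ C ∧ ∀ x ∈ Disk n, ‖f x‖ ≤ C := by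
  obtain ⟨C, hC⟩ := isCompact_disk.exists_bound_of_continuousOn hf
  exact ⟨C, (norm_nonneg _).trans (hC 0 zero_mem_disk), hC⟩

lemma norm_sub_le_of_diskDeriv_bound {f : Euc n → F}
    (hf : ContDiffOn ℝ (⊤ : ℕ∞) f (Disk n)) {C : ℝ} (hC : ∀ x ∈ Disk n, ‖𝒟[f] x‖ ≤ C)
    {x y : Euc n} (hx : x ∈ Disk n) (hy : y ∈ Disk n) : ‖f x - f y‖ ≤ C * ‖x - y‖ :=
  convex_disk.norm_image_sub_le_of_norm_fderivWithin_le
    (fun _ hz => hf.diffWithinAt_disk hz) hC hy hx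

/-- A function on the disk that is constant on the boundary has vanishing tangential
derivatives there. -/
lemma diskDeriv_tangential_eq_zero {f : Euc n → ℝ} (hf : ContDiffOn ℝ (⊤ : ℕ∞) f (Disk n))
    {c : ℝ} (hc : ∀ x ∈ DiskBdry n, f x = c) {x : Euc n} (hx : x ∈ DiskBdry n) {w : Euc n}
    (hw : ⟪w, x⟫ = 0) : 𝒟[f] x w = 0 := by
  rcases eq_or_ne w 0 with rfl | hw0
  · simp
  wlog hw1 : ‖w‖ = 1 generalizing w
  · have h := this (w := ‖w‖⁻¹ • w) (by simp [inner_smul_left, hw]) (by simp [hw0])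
      (by simp [norm_smul, hw0])
    simpa [hw0] using h
  have hx1 : ‖x‖ = 1 := by simpa [DiskBdry] using hx
  set γ : ℝ → Euc n := fun s => Real.cos s • x + Real.sin s • w with hγ
  have hγmem : ∀ s, γ s ∈ DiskBdry n := by
    intro s
    have h1 : ‖γ s‖ ^ 2 = 1 := by
      rw [hγ, @norm_add_sq_real]
      simp [norm_smul, inner_smul_left, inner_smul_right, real_inner_comm w x, hw, hx1, hw1]
    simpa [DiskBdry] using
      (pow_eq_one_iff_of_nonneg (norm_nonneg _) two_ne_zero).1 h1
  have hγ0 : γ 0 = x := by simp [hγ]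
  have hγd : HasDerivAt γ w 0 := by
    have := ((Real.hasDerivAt_cos 0).smul_const x).add ((Real.hasDerivAt_sin 0).smul_const w)
    simp only [Real.sin_zero, neg_zero, zero_smul, Real.cos_zero, one_smul, zero_add] at this
    exact this
  have hfd : HasFDerivWithinAt f (𝒟[f] x) (Disk n) (γ 0) := by
    rw [hγ0]; exact (hf.diffWithinAt_disk (diskBdry_subset_disk hx)).hasFDerivWithinAt
  have h2 := hfd.comp_hasDerivWithinAt (s := univ) 0 hγd.hasDerivWithinAt
    (fun s _ => diskBdry_subset_disk (hγmem s))
  have h3 : f ∘ γ = fun _ => c := funext fun s => hc _ (hγmem s)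
  rw [h3, hasDerivWithinAt_univ] at h2
  exact h2.unique (hasDerivAt_const 0 c)

/-- If moreover `⟪w, x⟫ ≠ 0` is allowed, only the radial component contributes. -/
lemma diskDeriv_eq_radial {f : Euc n → ℝ} (hf : ContDiffOn ℝ (⊤ : ℕ∞) f (Disk n))
    {c : ℝ} (hc : ∀ x ∈ DiskBdry n, f x = c) {x : Euc n} (hx : x ∈ DiskBdry n) (w : Euc n) :
    𝒟[f] x w = ⟪w, x⟫ * 𝒟[f] x x := by
  have hx1 : ‖x‖ = 1 := by simpa [DiskBdry] using hx
  have h := diskDeriv_tangential_eq_zero hf hc hx (w := w - ⟪w, x⟫ • x)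
    (by simp [inner_sub_left, inner_smul_left, hx1])
  rw [map_sub, map_smul, sub_eq_zero] at h
  simpa using h

end DiskCalculus

section Basic

variable (S : HypDisk n)

lemma HypDisk.inner_deriv_N {x : Euc n} (hx : x ∈ Disk n) (w : Euc n) :
    ⟪S.N x, 𝒟[S.N] x w⟫ = 0 := by
  have h := diskDeriv_inner S.smoothN S.smoothN hx w
  have h1 : 𝒟[fun y => ⟪S.N y, S.N y⟫] x = 𝒟[fun _ => (1 : ℝ)] x :=
    fderivWithin_congr' (fun y hy => by simp [S.unitN y hy]) hx
  rw [h1, real_inner_comm (S.N x)] at h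
  simp at h
  linarith

lemma HypDisk.inner_secondDeriv {x : Euc n} (hx : x ∈ Disk n) (v w : Euc n) :
    ⟪𝒟[𝒟[S.X]] x v w, S.N x⟫ = -⟪𝒟[S.X] x w, 𝒟[S.N] x v⟫ := by
  have h := diskDeriv_inner (contDiffOn_deriv_apply S.smoothX w) S.smoothN hx v
  have h1 : 𝒟[fun y => ⟪𝒟[S.X] y w, S.N y⟫] x = 𝒟[fun _ => (0 : ℝ)] x :=
    fderivWithin_congr' (fun y hy => S.perpN y hy w) hx
  rw [h1, diskDeriv_deriv_apply S.smoothX hx] at h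
  simp at h
  linarith

lemma HypDisk.inner_weingarten_symm {x : Euc n} (hx : x ∈ Disk n) (v w : Euc n) :
    ⟪𝒟[S.X] x w, 𝒟[S.N] x v⟫ = ⟪𝒟[S.X] x v, 𝒟[S.N] x w⟫ := by
  have h1 := S.inner_secondDeriv hx v w
  have h2 := S.inner_secondDeriv hx w v
  rw [diskDeriv_deriv_symm S.smoothX hx] at h1
  linarith

lemma HypDisk.exists_deriv_eq {x : Euc n} (hx : x ∈ Disk n) {y : Euc (n + 1)}
    (hy : ⟪y, S.N x⟫ = 0) : ∃ w, 𝒟[S.X] x w = y := by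
  have hN : S.N x ≠ 0 := by
    intro h; simpa [h] using S.unitN x hx
  have hle : LinearMap.range (𝒟[S.X] x).toLinearMap ≤ (Submodule.span ℝ {S.N x})ᗮ := by
    rintro _ ⟨w, rfl⟩
    rw [Submodule.mem_orthogonal_singleton_iff_inner_left]
    exact S.perpN x hx w
  have h1 : Module.finrank ℝ (LinearMap.range (𝒟[S.X] x).toLinearMap) = n := by
    rw [LinearMap.finrank_range_of_inj (S.immersion x hx)]
    simp
  have h2 : Module.finrank ℝ (Submodule.span ℝ {S.N x})ᗮ = n := by
    have : Fact (Module.finrank ℝ (Euc (n + 1)) = n + 1) := ⟨by simp⟩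
    exact Submodule.finrank_orthogonal_span_singleton hN
  have h3 := Submodule.eq_of_le_of_finrank_eq hle (h1.trans h2.symm)
  have h4 : y ∈ (Submodule.span ℝ {S.N x})ᗮ := by
    rwa [Submodule.mem_orthogonal_singleton_iff_inner_left]
  rw [← h3] at h4
  exact h4

lemma sff_apply {x : Euc n} (hx : x ∈ Disk n) (i j : Fin n) :
    sff S x i j = -⟪𝒟[𝒟[S.X]] x (EuclideanSpace.single j 1) (EuclideanSpace.single i 1),
      S.N x⟫ := by
  simp [sff, diskDeriv_deriv_apply S.smoothX hx]

lemma toLp_eq_sum_single (v : Fin n → ℝ) :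
    (WithLp.toLp 2 v : Euc n) = ∑ i, v i • EuclideanSpace.single i (1 : ℝ) := by
  ext j
  simp [Pi.single_apply]

lemma dotProduct_sff_mulVec {x : Euc n} (hx : x ∈ Disk n) (v : Fin n → ℝ) :
    star v ⬝ᵥ (sff S x).mulVec v =
      -⟪𝒟[𝒟[S.X]] x (WithLp.toLp 2 v) (WithLp.toLp 2 v), S.N x⟫ := by
  simp only [toLp_eq_sum_single, map_sum, map_smul, sum_apply,
    smul_apply, sum_inner, inner_smul_left, dotProduct, Matrix.mulVec,
    sff_apply S hx]
  simp [Finset.mul_sum]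
  refine Finset.sum_congr rfl fun i _ => Finset.sum_congr rfl fun j _ => ?_
  ring

lemma sff_isHermitian {x : Euc n} (hx : x ∈ Disk n) : (sff S x).IsHermitian := by
  ext i j
  simp [sff_apply S hx, diskDeriv_deriv_symm S.smoothX hx (EuclideanSpace.single i 1)]

lemma sff_posDef_of {x : Euc n} (hx : x ∈ Disk n)
    (h : ∀ v : Euc n, v ≠ 0 → ⟪𝒟[𝒟[S.X]] x v v, S.N x⟫ < 0) : (sff S x).PosDef := by
  refine Matrix.PosDef.of_dotProduct_mulVec_pos (sff_isHermitian S hx) fun v hv => ?_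
  rw [dotProduct_sff_mulVec S hx]
  have := h (WithLp.toLp 2 v) (by simpa using hv)
  linarith

lemma WeaklyConvex.inner_weingarten_nonneg {S : HypDisk n} (hS : WeaklyConvex S) {x : Euc n}
    (hx : x ∈ Disk n) (v : Euc n) : 0 ≤ ⟪𝒟[S.X] x v, 𝒟[S.N] x v⟫ := by
  have h := (hS x hx).dotProduct_mulVec_nonneg v.ofLp
  rw [dotProduct_sff_mulVec S hx, S.inner_secondDeriv hx] at h
  simpa using h

lemma gmet_det_pos {x : Euc n} (hx : x ∈ Disk n) : 0 < (gmet S x).det := by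
  refine Matrix.PosDef.det_pos (Matrix.PosDef.of_dotProduct_mulVec_pos ?_ fun v hv => ?_)
  · ext i j
    simp [gmet, real_inner_comm]
  · have h : star v ⬝ᵥ (gmet S x).mulVec v =
        ⟪𝒟[S.X] x (WithLp.toLp 2 v), 𝒟[S.X] x (WithLp.toLp 2 v)⟫ := by
      simp only [toLp_eq_sum_single, map_sum, map_smul, sum_inner, inner_sum, inner_smul_left,
        inner_smul_right, dotProduct, Matrix.mulVec, gmet]
      simp [Finset.mul_sum]
      rw [Finset.sum_comm]
      refine Finset.sum_congr rfl fun i _ => Finset.sum_congr rfl fun j _ => ?_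
      rw [real_inner_comm]
      ring
    rw [h, real_inner_self_pos]
    intro h0
    exact hv (by simpa using (S.immersion x hx) (h0.trans (map_zero _).symm))

end Basic

section Perturbation

lemma diskDeriv_quadratic {F : Type*} [NormedAddCommGroup F] [NormedSpace ℝ F]
    {f g k : Euc n → F} (hf : ContDiffOn ℝ (⊤ : ℕ∞) f (Disk n))
    (hg : ContDiffOn ℝ (⊤ : ℕ∞) g (Disk n)) (hk : ContDiffOn ℝ (⊤ : ℕ∞) k (Disk n)) (c t : ℝ)
    {x : Euc n} (hx : x ∈ Disk n) :
    𝒟[fun y => c • (f y + (t • g y + t ^ 2 • k y))] x =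
      c • (𝒟[f] x + (t • 𝒟[g] x + t ^ 2 • 𝒟[k] x)) := by
  have h1 := (hf.diffWithinAt_disk hx).hasFDerivWithinAt
  have h2 := (hg.diffWithinAt_disk hx).hasFDerivWithinAt
  have h3 := (hk.diffWithinAt_disk hx).hasFDerivWithinAt
  exact ((h1.add ((h2.const_smul t).add (h3.const_smul (t ^ 2)))).const_smul c).fderivWithin
    (uniqueDiffOn_disk x hx)

/-- The adjoint as a continuous linear map. -/
def adjointCLM (n : ℕ) : (Euc n →L[ℝ] Euc (n + 1)) →L[ℝ] (Euc (n + 1) →L[ℝ] Euc n) :=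
  LinearMap.toContinuousLinearMap
    { toFun := fun T => ContinuousLinearMap.adjoint T
      map_add' := fun T T' => map_add _ T T'
      map_smul' := fun c T => by simp }

lemma inner_adjointCLM (T : Euc n →L[ℝ] Euc (n + 1)) (w : Euc n) (y : Euc (n + 1)) :
    ⟪w, adjointCLM n T y⟫ = ⟪T w, y⟫ :=
  ContinuousLinearMap.adjoint_inner_right T w y

variable (S : HypDisk n)

/-- First order coefficient of the perturbation: the normal field `-(1 + |X|²)/2 • N`. -/
def perturbA (x : Euc n) : Euc (n + 1) := -(((1 + ‖S.X x‖ ^ 2) / 2) • S.N x)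

/-- Second order coefficient of the perturbation: the normal part `⟪X, N⟫ N` of the position. -/
def perturbB (x : Euc n) : Euc (n + 1) := ⟪S.X x, S.N x⟫ • S.N x

/-- Common factor normalising the perturbed boundary to the unit sphere. -/
def perturbScale (t : ℝ) : ℝ := (√(1 + t ^ 2))⁻¹

/-- The perturbed immersion. -/
def perturbX (t : ℝ) (x : Euc n) : Euc (n + 1) :=
  perturbScale t • (S.X x + (t • perturbA S x + t ^ 2 • perturbB S x))

/-- The derivative of the perturbed immersion, up to the factor `perturbScale t`. -/
def perturbL (t : ℝ) (x : Euc n) : Euc n →L[ℝ] Euc (n + 1) :=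
  𝒟[S.X] x + (t • 𝒟[perturbA S] x + t ^ 2 • 𝒟[perturbB S] x)

/-- The second derivative of the perturbed immersion, up to the factor `perturbScale t`. -/
def perturbD2 (t : ℝ) (x : Euc n) : Euc n →L[ℝ] Euc n →L[ℝ] Euc (n + 1) :=
  𝒟[𝒟[S.X]] x + (t • 𝒟[𝒟[perturbA S]] x + t ^ 2 • 𝒟[𝒟[perturbB S]] x)

/-- The operator `(dY)^* dX` relating the perturbed map `Y` to the initial one. -/
def perturbK (t : ℝ) (x : Euc n) : Euc n →L[ℝ] Euc n :=
  adjointCLM n (perturbL S t x) ∘L 𝒟[S.X] x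

/-- A normal field of the perturbed hypersurface with `⟪ν, N⟫ = 1`. -/
def perturbNu (t : ℝ) (x : Euc n) : Euc (n + 1) :=
  S.N x - 𝒟[S.X] x (Ring.inverse (perturbK S t x) (adjointCLM n (perturbL S t x) (S.N x)))

/-- The unit normal field of the perturbed hypersurface. -/
def perturbN (t : ℝ) (x : Euc n) : Euc (n + 1) := ‖perturbNu S t x‖⁻¹ • perturbNu S t x

lemma perturbScale_pos (t : ℝ) : 0 < perturbScale t := by
  unfold perturbScale; positivity

lemma perturbScale_sq_mul (t : ℝ) : perturbScale t ^ 2 * (1 + t ^ 2) = 1 := by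
  have h : 0 < 1 + t ^ 2 := by positivity
  rw [perturbScale, inv_pow, Real.sq_sqrt h.le, inv_mul_cancel₀ h.ne']

lemma continuous_perturbScale : Continuous perturbScale :=
  Continuous.inv₀ (by fun_prop) fun t => by positivity

lemma perturbScale_zero : perturbScale 0 = 1 := by simp [perturbScale]

lemma smooth_perturbA : ContDiffOn ℝ (⊤ : ℕ∞) (perturbA S) (Disk n) :=
  (ContDiffOn.smul ((contDiffOn_const.add (S.smoothX.norm_sq ℝ)).div_const 2) S.smoothN).neg

lemma smooth_perturbB : ContDiffOn ℝ (⊤ : ℕ∞) (perturbB S) (Disk n) :=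
  (S.smoothX.inner ℝ S.smoothN).smul S.smoothN

lemma smooth_perturbX (t : ℝ) : ContDiffOn ℝ (⊤ : ℕ∞) (perturbX S t) (Disk n) :=
  (S.smoothX.add (((smooth_perturbA S).const_smul t).add
    ((smooth_perturbB S).const_smul (t ^ 2)))).const_smul _

lemma diskDeriv_perturbX (t : ℝ) {x : Euc n} (hx : x ∈ Disk n) :
    𝒟[perturbX S t] x = perturbScale t • perturbL S t x :=
  diskDeriv_quadratic S.smoothX (smooth_perturbA S) (smooth_perturbB S) _ t hx

lemma diskDeriv_deriv_perturbX (t : ℝ) {x : Euc n} (hx : x ∈ Disk n) :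
    𝒟[𝒟[perturbX S t]] x = perturbScale t • perturbD2 S t x := by
  rw [fderivWithin_congr' (fun y hy => diskDeriv_perturbX S t hy) hx]
  exact diskDeriv_quadratic S.smoothX.diskDeriv (smooth_perturbA S).diskDeriv
    (smooth_perturbB S).diskDeriv _ t hx

lemma smooth_perturbL (t : ℝ) : ContDiffOn ℝ (⊤ : ℕ∞) (perturbL S t) (Disk n) :=
  S.smoothX.diskDeriv.add (((smooth_perturbA S).diskDeriv.const_smul t).add
    ((smooth_perturbB S).diskDeriv.const_smul (t ^ 2)))

lemma smooth_perturbK (t : ℝ) : ContDiffOn ℝ (⊤ : ℕ∞) (perturbK S t) (Disk n) :=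
  ((adjointCLM n).contDiff.comp_contDiffOn (smooth_perturbL S t)).clm_comp S.smoothX.diskDeriv

lemma smooth_perturbNu {t : ℝ} (hK : ∀ x ∈ Disk n, IsUnit (perturbK S t x)) :
    ContDiffOn ℝ (⊤ : ℕ∞) (perturbNu S t) (Disk n) := by
  have hinv : ContDiffOn ℝ (⊤ : ℕ∞) (fun x => Ring.inverse (perturbK S t x)) (Disk n) := by
    intro x hx
    obtain ⟨u, hu⟩ := hK x hx
    have h := contDiffAt_ringInverse ℝ (n := (⊤ : ℕ∞)) u
    rw [hu] at h
    exact h.comp_contDiffWithinAt x (smooth_perturbK S t x hx)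
  exact S.smoothN.sub (S.smoothX.diskDeriv.clm_apply (hinv.clm_apply
    (((adjointCLM n).contDiff.comp_contDiffOn (smooth_perturbL S t)).clm_apply S.smoothN)))

lemma continuousOn_uncurry_perturbL (s : Set ℝ) :
    ContinuousOn (fun z : ℝ × Euc n => perturbL S z.1 z.2) (s ×ˢ Disk n) := by
  have hm : MapsTo (Prod.snd : ℝ × Euc n → Euc n) (s ×ˢ Disk n) (Disk n) := fun z hz => hz.2
  have h1 := S.smoothX.diskDeriv.continuousOn.comp continuousOn_snd hm
  have h2 := (smooth_perturbA S).diskDeriv.continuousOn.comp continuousOn_snd hm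
  have h3 := (smooth_perturbB S).diskDeriv.continuousOn.comp continuousOn_snd hm
  exact h1.add ((continuousOn_fst.smul h2).add ((continuousOn_fst.pow 2).smul h3))

lemma continuousOn_uncurry_perturbD2 (s : Set ℝ) :
    ContinuousOn (fun z : ℝ × Euc n => perturbD2 S z.1 z.2) (s ×ˢ Disk n) := by
  have hm : MapsTo (Prod.snd : ℝ × Euc n → Euc n) (s ×ˢ Disk n) (Disk n) := fun z hz => hz.2
  have h1 := S.smoothX.diskDeriv.diskDeriv.continuousOn.comp continuousOn_snd hm
  have h2 := (smooth_perturbA S).diskDeriv.diskDeriv.continuousOn.comp continuousOn_snd hm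
  have h3 := (smooth_perturbB S).diskDeriv.diskDeriv.continuousOn.comp continuousOn_snd hm
  exact h1.add ((continuousOn_fst.smul h2).add ((continuousOn_fst.pow 2).smul h3))

lemma continuousOn_uncurry_perturbNu {s : Set ℝ}
    (hK : ∀ t ∈ s, ∀ x ∈ Disk n, IsUnit (perturbK S t x)) :
    ContinuousOn (fun z : ℝ × Euc n => perturbNu S z.1 z.2) (s ×ˢ Disk n) := by
  have hm : MapsTo (Prod.snd : ℝ × Euc n → Euc n) (s ×ˢ Disk n) (Disk n) := fun z hz => hz.2
  have h1 := S.smoothX.diskDeriv.continuousOn.comp continuousOn_snd hm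
  have h2 := S.smoothN.continuousOn.comp continuousOn_snd hm
  have h3 : ContinuousOn (fun z : ℝ × Euc n => adjointCLM n (perturbL S z.1 z.2))
      (s ×ˢ Disk n) :=
    (adjointCLM n).continuous.comp_continuousOn (continuousOn_uncurry_perturbL S s)
  have h4 : ContinuousOn (fun z : ℝ × Euc n => perturbK S z.1 z.2) (s ×ˢ Disk n) :=
    h3.clm_comp h1
  have hinv : ContinuousOn (fun z : ℝ × Euc n => Ring.inverse (perturbK S z.1 z.2))
      (s ×ˢ Disk n) := by
    intro z hz
    obtain ⟨u, hu⟩ := hK z.1 hz.1 z.2 hz.2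
    have h := NormedRing.inverse_continuousAt u
    rw [hu] at h
    exact h.comp_continuousWithinAt (f := fun z : ℝ × Euc n => perturbK S z.1 z.2) (h4 z hz)
  exact h2.sub (h1.clm_apply (hinv.clm_apply (h3.clm_apply h2)))

end Perturbation

section Bounds

/-- Uniform bounds for the geometry of a hypersurface and its perturbation coefficients. -/
structure DiskBounds (S : HypDisk n) (m C : ℝ) : Prop where
  m_pos : 0 < m
  C_pos : 0 < C
  X_le : ∀ x ∈ Disk n, ‖S.X x‖ ≤ C
  dX_le : ∀ x ∈ Disk n, ‖𝒟[S.X] x‖ ≤ C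
  dN_le : ∀ x ∈ Disk n, ‖𝒟[S.N] x‖ ≤ C
  dA_le : ∀ x ∈ Disk n, ‖𝒟[perturbA S] x‖ ≤ C
  dB_le : ∀ x ∈ Disk n, ‖𝒟[perturbB S] x‖ ≤ C
  ddX_le : ∀ x ∈ Disk n, ‖𝒟[𝒟[S.X]] x‖ ≤ C
  ddA_le : ∀ x ∈ Disk n, ‖𝒟[𝒟[perturbA S]] x‖ ≤ C
  ddB_le : ∀ x ∈ Disk n, ‖𝒟[𝒟[perturbB S]] x‖ ≤ C
  le_dX : ∀ x ∈ Disk n, ∀ w, m * ‖w‖ ≤ ‖𝒟[S.X] x w‖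
  le_dist : ∀ x ∈ Disk n, ∀ y ∈ Disk n, m * ‖x - y‖ ≤ ‖S.X x - S.X y‖

variable (S : HypDisk n)

lemma HypDisk.exists_le_deriv : ∃ m, 0 < m ∧ ∀ x ∈ Disk n, ∀ w, m * ‖w‖ ≤ ‖𝒟[S.X] x w‖ := by
  have hcont : ContinuousOn (fun z : Euc n × Euc n => ‖𝒟[S.X] z.1 z.2‖)
      (Disk n ×ˢ DiskBdry n) :=
    ((S.smoothX.diskDeriv.continuousOn.comp continuousOn_fst fun z hz => hz.1).clm_apply
      continuousOn_snd).norm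
  obtain ⟨m, hm, h⟩ := (isCompact_disk.prod (isCompact_sphere 0 1)).exists_forall_le' hcont
    (a := 0) (fun z hz => by
      rw [norm_pos_iff]
      intro h0
      have h1 := S.immersion z.1 hz.1 (h0.trans (map_zero _).symm)
      have h2 : ‖z.2‖ = 1 := by simpa using hz.2
      simp [h1] at h2)
  refine ⟨m, hm, fun x hx w => ?_⟩
  rcases eq_or_ne w 0 with rfl | hw
  · simp
  have hw' : 0 < ‖w‖ := norm_pos_iff.2 hw
  have h1 := h (x, ‖w‖⁻¹ • w) ⟨hx, by simp [norm_smul, hw]⟩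
  simp only [map_smul, norm_smul, norm_inv, norm_norm] at h1
  rwa [le_inv_mul_iff₀ hw', mul_comm] at h1

lemma HypDisk.exists_le_dist :
    ∃ m, 0 < m ∧ ∀ x ∈ Disk n, ∀ y ∈ Disk n, m * ‖x - y‖ ≤ ‖S.X x - S.X y‖ := by
  obtain ⟨m, hm, hmd⟩ := S.exists_le_deriv
  have huc := isCompact_disk.uniformContinuousOn_of_continuous S.smoothX.diskDeriv.continuousOn
  obtain ⟨δ, hδ, hδ'⟩ := Metric.uniformContinuousOn_iff.1 huc (m / 2) (by positivity)
  have hcpt : IsCompact {z : Euc n × Euc n | z ∈ Disk n ×ˢ Disk n ∧ δ ≤ ‖z.1 - z.2‖} := by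
    refine (isCompact_disk.prod isCompact_disk).inter_right ?_
    exact isClosed_le (g := fun z : Euc n × Euc n => ‖z.1 - z.2‖) continuous_const (by fun_prop)
  have hcont : ContinuousOn (fun z : Euc n × Euc n => ‖S.X z.1 - S.X z.2‖)
      {z : Euc n × Euc n | z ∈ Disk n ×ˢ Disk n ∧ δ ≤ ‖z.1 - z.2‖} :=
    ((S.smoothX.continuousOn.comp continuousOn_fst fun z hz => hz.1.1).sub
      (S.smoothX.continuousOn.comp continuousOn_snd fun z hz => hz.1.2)).norm
  obtain ⟨m', hm', h'⟩ := hcpt.exists_forall_le' hcont (a := 0) (fun z hz => by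
    rw [norm_pos_iff, sub_ne_zero]
    intro h0
    have h1 := S.injX hz.1.1 hz.1.2 h0
    have h2 := hz.2
    simp [h1] at h2
    linarith)
  refine ⟨min (m / 2) (m' / 2), by positivity, fun x hx y hy => ?_⟩
  rcases lt_or_ge ‖x - y‖ δ with hlt | hge
  · have hmem : ∀ z ∈ Disk n ∩ ball y δ, ‖𝒟[S.X] z - 𝒟[S.X] y‖ ≤ m / 2 := by
      intro z hz
      rw [← dist_eq_norm]
      exact (hδ' z hz.1 y hy hz.2).le
    have h1 := Convex.norm_image_sub_le_of_norm_hasFDerivWithin_le' (f := S.X)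
      (f' := 𝒟[S.X]) (φ := 𝒟[S.X] y) (x := y) (y := x)
      (fun z hz => ((S.smoothX.diffWithinAt_disk hz.1).hasFDerivWithinAt.mono
        inter_subset_left)) hmem (convex_disk.inter (convex_ball y δ))
      ⟨hy, mem_ball_self hδ⟩ ⟨hx, by rwa [mem_ball, dist_eq_norm]⟩
    have h2 := hmd y hy (x - y)
    have h3 := norm_sub_norm_le (𝒟[S.X] y (x - y)) (S.X x - S.X y)
    rw [norm_sub_rev (𝒟[S.X] y (x - y))] at h3
    have h4 : min (m / 2) (m' / 2) * ‖x - y‖ ≤ m / 2 * ‖x - y‖ := by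
      gcongr; exact min_le_left _ _
    linarith
  · have h1 := h' (x, y) ⟨⟨hx, hy⟩, hge⟩
    have h2 : ‖x - y‖ ≤ 2 := by
      have := norm_sub_le x y
      have hx' : ‖x‖ ≤ 1 := by simpa [Disk] using hx
      have hy' : ‖y‖ ≤ 1 := by simpa [Disk] using hy
      linarith
    have h4 : min (m / 2) (m' / 2) * ‖x - y‖ ≤ m' / 2 * 2 := by
      gcongr; exact min_le_right _ _
    simp only at h1
    linarith

lemma HypDisk.exists_diskBounds : ∃ m C, DiskBounds S m C := by
  obtain ⟨m₁, hm₁, h₁⟩ := S.exists_le_deriv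
  obtain ⟨m₂, hm₂, h₂⟩ := S.exists_le_dist
  have hA := smooth_perturbA S
  have hB := smooth_perturbB S
  obtain ⟨C₁, p₁, b₁⟩ := S.smoothX.continuousOn.exists_bound_disk
  obtain ⟨C₂, p₂, b₂⟩ := S.smoothX.diskDeriv.continuousOn.exists_bound_disk
  obtain ⟨C₃, p₃, b₃⟩ := S.smoothN.diskDeriv.continuousOn.exists_bound_disk
  obtain ⟨C₄, p₄, b₄⟩ := hA.diskDeriv.continuousOn.exists_bound_disk
  obtain ⟨C₅, p₅, b₅⟩ := hB.diskDeriv.continuousOn.exists_bound_disk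
  obtain ⟨C₆, p₆, b₆⟩ := S.smoothX.diskDeriv.diskDeriv.continuousOn.exists_bound_disk
  obtain ⟨C₇, p₇, b₇⟩ := hA.diskDeriv.diskDeriv.continuousOn.exists_bound_disk
  obtain ⟨C₈, p₈, b₈⟩ := hB.diskDeriv.diskDeriv.continuousOn.exists_bound_disk
  refine ⟨min m₁ m₂, C₁ + C₂ + C₃ + C₄ + C₅ + C₆ + C₇ + C₈ + 1,
    ⟨by positivity, by positivity, fun x hx => ?_, fun x hx => ?_, fun x hx => ?_,
    fun x hx => ?_, fun x hx => ?_, fun x hx => ?_, fun x hx => ?_, fun x hx => ?_,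
    fun x hx w => le_trans (by gcongr; exact min_le_left _ _) (h₁ x hx w),
    fun x hx y hy => le_trans (by gcongr; exact min_le_right _ _) (h₂ x hx y hy)⟩⟩
  · linarith [b₁ x hx]
  · linarith [b₂ x hx]
  · linarith [b₃ x hx]
  · linarith [b₄ x hx]
  · linarith [b₅ x hx]
  · linarith [b₆ x hx]
  · linarith [b₇ x hx]
  · linarith [b₈ x hx]

end Bounds

section Estimates

variable {S : HypDisk n} {m C t : ℝ}

lemma norm_quadratic_le {G : Type*} [NormedAddCommGroup G] [NormedSpace ℝ G] {a b : G} {r : ℝ}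
    (ht0 : 0 ≤ t) (ht1 : t ≤ 1) (ha : ‖a‖ ≤ r) (hb : ‖b‖ ≤ r) :
    ‖t • a + t ^ 2 • b‖ ≤ 2 * r * t := by
  have h1 : ‖t • a‖ ≤ t * r := by
    rw [norm_smul, Real.norm_of_nonneg ht0]; gcongr
  have h2 : ‖t ^ 2 • b‖ ≤ t * r := by
    rw [norm_smul, Real.norm_of_nonneg (by positivity)]
    have : 0 ≤ r := (norm_nonneg _).trans ha
    gcongr
    nlinarith
  linarith [norm_add_le (t • a) (t ^ 2 • b)]

lemma perturbL_apply (t : ℝ) (x w : Euc n) :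
    perturbL S t x w =
      𝒟[S.X] x w + (t • 𝒟[perturbA S] x w + t ^ 2 • 𝒟[perturbB S] x w) := rfl

lemma DiskBounds.norm_perturbL_sub_le (hb : DiskBounds S m C) (ht0 : 0 ≤ t) (ht1 : t ≤ 1)
    {x : Euc n} (hx : x ∈ Disk n) (w : Euc n) :
    ‖t • 𝒟[perturbA S] x w + t ^ 2 • 𝒟[perturbB S] x w‖ ≤ 2 * C * t * ‖w‖ := by
  have h := norm_quadratic_le ht0 ht1 (ContinuousLinearMap.le_of_opNorm_le _ (hb.dA_le x hx) w)
    (ContinuousLinearMap.le_of_opNorm_le _ (hb.dB_le x hx) w)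
  linarith

lemma DiskBounds.coercive (hb : DiskBounds S m C) (ht0 : 0 ≤ t) (ht1 : t ≤ 1)
    (ht : 4 * C * t ≤ m) {x : Euc n} (hx : x ∈ Disk n) (w : Euc n) :
    m ^ 2 / 2 * ‖w‖ ^ 2 ≤ ⟪perturbL S t x w, 𝒟[S.X] x w⟫ := by
  rw [perturbL_apply, inner_add_left, real_inner_self_eq_norm_sq]
  have h1 := hb.norm_perturbL_sub_le ht0 ht1 hx w
  have h2 := hb.le_dX x hx w
  have h3 := (abs_le.1 (abs_real_inner_le_norm
    (t • 𝒟[perturbA S] x w + t ^ 2 • 𝒟[perturbB S] x w) (𝒟[S.X] x w))).1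
  have h4 : ‖t • 𝒟[perturbA S] x w + t ^ 2 • 𝒟[perturbB S] x w‖ ≤ m / 2 * ‖w‖ := by
    refine h1.trans ?_
    gcongr
    linarith
  have h5 := mul_le_mul_of_nonneg_right h4 (norm_nonneg (𝒟[S.X] x w))
  have hm := hb.m_pos
  have h6 : m * ‖w‖ * (m / 2 * ‖w‖) ≤
      ‖𝒟[S.X] x w‖ * (‖𝒟[S.X] x w‖ - m / 2 * ‖w‖) := by
    apply mul_le_mul h2 (by linarith) (by positivity) (norm_nonneg _)
  nlinarith

lemma inner_perturbK (t : ℝ) (x v w : Euc n) :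
    ⟪v, perturbK S t x w⟫ = ⟪perturbL S t x v, 𝒟[S.X] x w⟫ :=
  inner_adjointCLM _ _ _

lemma DiskBounds.isUnit_perturbK (hb : DiskBounds S m C) (ht0 : 0 ≤ t) (ht1 : t ≤ 1)
    (ht : 4 * C * t ≤ m) {x : Euc n} (hx : x ∈ Disk n) : IsUnit (perturbK S t x) := by
  have hinj : Function.Injective (perturbK S t x) := by
    rw [injective_iff_map_eq_zero]
    intro w hw
    have h := hb.coercive ht0 ht1 ht hx w
    rw [← inner_perturbK, hw, inner_zero_right] at h
    have := hb.m_pos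
    by_contra hne
    have : 0 < ‖w‖ := norm_pos_iff.2 hne
    have : 0 < m ^ 2 / 2 * ‖w‖ ^ 2 := by positivity
    linarith
  exact ContinuousLinearMap.isUnit_iff_bijective.2
    ⟨hinj, (perturbK S t x).toLinearMap.injective_iff_surjective.1 hinj⟩

/-- The normal field of the perturbed hypersurface differs from `N` by a small tangential
vector. -/
lemma DiskBounds.exists_perturbNu_eq (hb : DiskBounds S m C) (ht0 : 0 ≤ t) (ht1 : t ≤ 1)
    (ht : 4 * C * t ≤ m) {x : Euc n} (hx : x ∈ Disk n) :
    ∃ ζ, perturbNu S t x = S.N x - 𝒟[S.X] x ζ ∧ ‖ζ‖ ≤ 4 * C / m ^ 2 * t ∧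
      ∀ w, ⟪perturbL S t x w, perturbNu S t x⟫ = 0 := by
  set ζ := Ring.inverse (perturbK S t x) (adjointCLM n (perturbL S t x) (S.N x)) with hζ
  have hm := hb.m_pos
  have hC := hb.C_pos
  have hK : perturbK S t x ζ = adjointCLM n (perturbL S t x) (S.N x) := by
    have := Ring.mul_inverse_cancel _ (hb.isUnit_perturbK ht0 ht1 ht hx)
    exact congrArg (fun T => T (adjointCLM n (perturbL S t x) (S.N x))) this
  refine ⟨ζ, rfl, ?_, fun w => ?_⟩
  · have h1 := hb.coercive ht0 ht1 ht hx ζ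
    rw [← inner_perturbK, hK, inner_adjointCLM, perturbL_apply, inner_add_left, S.perpN x hx,
      zero_add] at h1
    have h2 := real_inner_le_norm
      (t • 𝒟[perturbA S] x ζ + t ^ 2 • 𝒟[perturbB S] x ζ) (S.N x)
    rw [S.unitN x hx, mul_one] at h2
    have h3 := (h1.trans h2).trans (hb.norm_perturbL_sub_le ht0 ht1 hx ζ)
    rcases (norm_nonneg ζ).eq_or_lt with h0 | h0
    · rw [← h0]; positivity
    · have h4 : m ^ 2 / 2 * ‖ζ‖ ≤ 2 * C * t := by
        refine le_of_mul_le_mul_right ?_ h0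
        linarith
      rw [div_mul_eq_mul_div, le_div_iff₀ (by positivity)]
      linarith
  · have h : perturbNu S t x = S.N x - 𝒟[S.X] x ζ := rfl
    rw [h, inner_sub_right, ← inner_perturbK, hK, inner_adjointCLM, sub_self]

lemma DiskBounds.inner_N_perturbNu (hb : DiskBounds S m C) (ht0 : 0 ≤ t) (ht1 : t ≤ 1)
    (ht : 4 * C * t ≤ m) {x : Euc n} (hx : x ∈ Disk n) : ⟪S.N x, perturbNu S t x⟫ = 1 := by
  obtain ⟨ζ, h, -, -⟩ := hb.exists_perturbNu_eq ht0 ht1 ht hx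
  rw [h, inner_sub_right, real_inner_comm, real_inner_comm (𝒟[S.X] x ζ), S.perpN x hx,
    real_inner_self_eq_norm_sq, S.unitN x hx]
  norm_num

lemma DiskBounds.perturbNu_ne_zero (hb : DiskBounds S m C) (ht0 : 0 ≤ t) (ht1 : t ≤ 1)
    (ht : 4 * C * t ≤ m) {x : Euc n} (hx : x ∈ Disk n) : perturbNu S t x ≠ 0 := by
  intro h
  have := hb.inner_N_perturbNu ht0 ht1 ht hx
  simp [h] at this

/-- The perturbed map moves differences by a relative amount of order `t`. -/
lemma DiskBounds.dist_perturb_le (hb : DiskBounds S m C) (ht0 : 0 ≤ t) (ht1 : t ≤ 1)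
    {x y : Euc n} (hx : x ∈ Disk n) (hy : y ∈ Disk n) :
    ‖(t • perturbA S x + t ^ 2 • perturbB S x) - (t • perturbA S y + t ^ 2 • perturbB S y)‖ ≤
      2 * C * t * ‖x - y‖ := by
  have h := norm_quadratic_le ht0 ht1
    (norm_sub_le_of_diskDeriv_bound (smooth_perturbA S) hb.dA_le hx hy)
    (norm_sub_le_of_diskDeriv_bound (smooth_perturbB S) hb.dB_le hx hy)
  rw [smul_sub, smul_sub, sub_add_sub_comm] at h
  linarith

/-- Squared norm of the shape operator is controlled by the second fundamental form. -/
lemma DiskBounds.norm_deriv_N_sq_le (hb : DiskBounds S m C) (hS : WeaklyConvex S)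
    {x : Euc n} (hx : x ∈ Disk n) (v : Euc n) :
    ‖𝒟[S.N] x v‖ ^ 2 ≤ C / m * ⟪𝒟[S.X] x v, 𝒟[S.N] x v⟫ := by
  have hm := hb.m_pos
  have hC := hb.C_pos
  obtain ⟨w, hw⟩ := S.exists_deriv_eq hx (y := 𝒟[S.N] x v)
    (by rw [real_inner_comm]; exact S.inner_deriv_N hx v)
  have h1 := hS.inner_weingarten_nonneg hx (v - (m / C) • w)
  have h2 : ⟪𝒟[S.X] x w, 𝒟[S.N] x v⟫ = ‖𝒟[S.N] x v‖ ^ 2 := by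
    rw [hw, real_inner_self_eq_norm_sq]
  have h3 : ⟪𝒟[S.X] x v, 𝒟[S.N] x w⟫ = ‖𝒟[S.N] x v‖ ^ 2 := by
    rw [← S.inner_weingarten_symm hx, h2]
  have h4 : ⟪𝒟[S.X] x w, 𝒟[S.N] x w⟫ ≤ C / m * ‖𝒟[S.N] x v‖ ^ 2 := by
    have h5 := hb.le_dX x hx w
    rw [hw] at h5
    have h6 := real_inner_le_norm (𝒟[S.X] x w) (𝒟[S.N] x w)
    have h7 := ContinuousLinearMap.le_of_opNorm_le _ (hb.dN_le x hx) w
    rw [hw] at h6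
    have h8 : ‖w‖ ≤ ‖𝒟[S.N] x v‖ / m := by
      rw [le_div_iff₀ hm]; linarith
    rw [hw]
    calc ⟪𝒟[S.N] x v, 𝒟[S.N] x w⟫ ≤ ‖𝒟[S.N] x v‖ * (C * (‖𝒟[S.N] x v‖ / m)) := by
          refine h6.trans ?_
          gcongr
          exact h7.trans (by gcongr)
      _ = _ := by ring
  simp only [map_sub, map_smul, inner_sub_left, inner_sub_right, inner_smul_left,
    inner_smul_right, h2, h3, conj_trivial] at h1
  have h5 : m / C * (m / C * ⟪𝒟[S.X] x w, 𝒟[S.N] x w⟫) ≤ m / C * ‖𝒟[S.N] x v‖ ^ 2 := by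
    have : m / C * (C / m * ‖𝒟[S.N] x v‖ ^ 2) = ‖𝒟[S.N] x v‖ ^ 2 := by field_simp
    have h9 := mul_le_mul_of_nonneg_left h4 (show 0 ≤ m / C by positivity)
    rw [this] at h9
    gcongr
  have h6 : m / C * ‖𝒟[S.N] x v‖ ^ 2 ≤ ⟪𝒟[S.X] x v, 𝒟[S.N] x v⟫ := by linarith
  have h7 := mul_le_mul_of_nonneg_left h6 (show 0 ≤ C / m by positivity)
  have : C / m * (m / C * ‖𝒟[S.N] x v‖ ^ 2) = ‖𝒟[S.N] x v‖ ^ 2 := by field_simp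
  linarith

lemma diskDeriv_perturbA {x : Euc n} (hx : x ∈ Disk n) (w : Euc n) :
    𝒟[perturbA S] x w =
      -(⟪S.X x, 𝒟[S.X] x w⟫ • S.N x + ((1 + ‖S.X x‖ ^ 2) / 2) • 𝒟[S.N] x w) := by
  have hX := (S.smoothX.diffWithinAt_disk hx).hasFDerivWithinAt
  have hN := (S.smoothN.diffWithinAt_disk hx).hasFDerivWithinAt
  have hq : HasFDerivWithinAt (fun y => (1 + ‖S.X y‖ ^ 2) / 2)
      ((2 : ℝ)⁻¹ • (2 • (innerSL ℝ (S.X x)).comp (𝒟[S.X] x))) (Disk n) x := by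
    have := (hX.norm_sq.const_add 1).const_smul (2 : ℝ)⁻¹
    refine HasFDerivWithinAt.congr' this (fun y _ => ?_) hx
    simp [div_eq_inv_mul]
  have h := (hq.smul hN).neg
  have h2 := h.fderivWithin (uniqueDiffOn_disk x hx)
  rw [show 𝒟[perturbA S] x = _ from h2]
  simp
  abel

lemma diskDeriv_perturbB {x : Euc n} (hx : x ∈ Disk n) (w : Euc n) :
    𝒟[perturbB S] x w = (⟪S.X x, 𝒟[S.N] x w⟫ + ⟪𝒟[S.X] x w, S.N x⟫) • S.N x +
      ⟪S.X x, S.N x⟫ • 𝒟[S.N] x w := by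
  have hX := (S.smoothX.diffWithinAt_disk hx).hasFDerivWithinAt
  have hN := (S.smoothN.diffWithinAt_disk hx).hasFDerivWithinAt
  have h2 := ((hX.inner ℝ hN).smul hN).fderivWithin (uniqueDiffOn_disk x hx)
  rw [show 𝒟[perturbB S] x = _ from h2]
  simp
  abel

lemma inner_diskDeriv_perturbA {x : Euc n} (hx : x ∈ Disk n) (w : Euc n) :
    ⟪𝒟[perturbA S] x w, S.N x⟫ = -⟪S.X x, 𝒟[S.X] x w⟫ := by
  rw [diskDeriv_perturbA hx, inner_neg_left, inner_add_left, inner_smul_left, inner_smul_left,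
    real_inner_comm (S.N x) (𝒟[S.N] x w), S.inner_deriv_N hx, real_inner_self_eq_norm_sq,
    S.unitN x hx]
  simp

lemma inner_secondDeriv_perturbA {x : Euc n} (hx : x ∈ Disk n) (v : Euc n) :
    ⟪𝒟[𝒟[perturbA S]] x v v, S.N x⟫ = (1 + ‖S.X x‖ ^ 2) / 2 * ‖𝒟[S.N] x v‖ ^ 2 -
      ‖𝒟[S.X] x v‖ ^ 2 - ⟪S.X x, 𝒟[𝒟[S.X]] x v v⟫ := by
  have hsX := contDiffOn_deriv_apply S.smoothX v
  have h1 := diskDeriv_inner (contDiffOn_deriv_apply (smooth_perturbA S) v) S.smoothN hx v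
  rw [fderivWithin_congr' (fun y hy => inner_diskDeriv_perturbA hy v) hx,
    diskDeriv_deriv_apply (smooth_perturbA S) hx, fderivWithin_fun_neg (uniqueDiffOn_disk x hx),
    neg_apply, diskDeriv_inner S.smoothX hsX hx, diskDeriv_deriv_apply S.smoothX hx,
    diskDeriv_perturbA hx, inner_neg_left, inner_add_left, inner_smul_left, inner_smul_left,
    S.inner_deriv_N hx, real_inner_self_eq_norm_sq, real_inner_self_eq_norm_sq] at h1
  simp only [conj_trivial, mul_zero, zero_add] at h1
  linarith

end Estimates

section Convexity

variable {S : HypDisk n} {m C t : ℝ}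

/-- Smallness of the deformation parameter relative to the bounds of the initial hypersurface. -/
structure IsSmallParam (m C t : ℝ) : Prop where
  nonneg : 0 ≤ t
  le_one : t ≤ 1
  le_m : 4 * C * t ≤ m
  le_form : t * (C + (1 + C ^ 2) / 2 * (C / m)) ≤ 1
  lt_sq : t * ((2 * C ^ 2 / m + C) * (1 + 8 * C ^ 2 / m ^ 2)) < m ^ 2

lemma exists_isSmallParam {m C : ℝ} (hm : 0 < m) (hC : 0 < C) :
    ∃ ε, 0 < ε ∧ ∀ t ∈ Icc 0 ε, IsSmallParam m C t := by
  have key : ∀ a b : ℝ, 0 < a → 0 < b → ∀ t ≤ b / a, t * a ≤ b := fun a b ha _ t ht =>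
    (le_div_iff₀ ha).1 ht
  set a := C + (1 + C ^ 2) / 2 * (C / m)
  set b := (2 * C ^ 2 / m + C) * (1 + 8 * C ^ 2 / m ^ 2)
  have ha : 0 < a := by positivity
  have hb : 0 < b := by positivity
  refine ⟨min (min 1 (m / (4 * C))) (min (1 / a) (m ^ 2 / 2 / b)), by positivity,
    fun t ht => ?_⟩
  have h := ht.2
  simp only [le_min_iff] at h
  obtain ⟨⟨h1, h2⟩, h3, h4⟩ := h
  refine ⟨ht.1, h1, ?_, key a 1 ha one_pos t h3, ?_⟩
  · have := key (4 * C) m (by positivity) hm t h2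
    linarith
  · have := key b (m ^ 2 / 2) hb (by positivity) t h4
    have : 0 < m ^ 2 := by positivity
    linarith

/-- The second fundamental form of the perturbed hypersurface is positive definite. -/
lemma DiskBounds.perturbD2_inner_neg (hb : DiskBounds S m C) (hS : WeaklyConvex S)
    (ht : IsSmallParam m C t) (ht0 : 0 < t) {x : Euc n} (hx : x ∈ Disk n) {v : Euc n}
    (hv : v ≠ 0) : ⟪perturbD2 S t x v v, perturbNu S t x⟫ < 0 := by
  have hm := hb.m_pos
  have hC := hb.C_pos
  obtain ⟨ζ, hν, hζ, hperp⟩ := hb.exists_perturbNu_eq ht.nonneg ht.le_one ht.le_m hx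
  have hN1 := hb.inner_N_perturbNu ht.nonneg ht.le_one ht.le_m hx
  set ν := perturbNu S t x
  set h := ⟪𝒟[S.X] x v, 𝒟[S.N] x v⟫ with hh
  set r := ‖v‖ ^ 2 with hr
  have hr0 : 0 < r := by have := norm_pos_iff.2 hv; positivity
  have hh0 : 0 ≤ h := hS.inner_weingarten_nonneg hx v
  have hNN : ⟪S.N x, S.N x⟫ = 1 := by rw [real_inner_self_eq_norm_sq, S.unitN x hx]; norm_num
  have hII : ⟪𝒟[𝒟[S.X]] x v v, S.N x⟫ = -h := S.inner_secondDeriv hx v v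
  -- the tangential part of the second derivative
  obtain ⟨Γ, hΓ⟩ := S.exists_deriv_eq hx (y := 𝒟[𝒟[S.X]] x v v + h • S.N x)
    (by rw [inner_add_left, inner_smul_left, hNN, hII]; simp)
  have bilin : ∀ T : Euc n →L[ℝ] Euc n →L[ℝ] Euc (n + 1), ‖T‖ ≤ C → ‖T v v‖ ≤ C * r := by
    intro T hT
    calc ‖T v v‖ ≤ ‖T‖ * ‖v‖ * ‖v‖ := T.le_opNorm₂ v v
      _ ≤ C * ‖v‖ * ‖v‖ := by gcongr
      _ = C * r := by rw [hr]; ring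
  have hX2 := bilin _ (hb.ddX_le x hx)
  have hhr : h ≤ C * r := by
    have h1 := (abs_le.1 (abs_real_inner_le_norm (𝒟[𝒟[S.X]] x v v) (S.N x))).1
    rw [hII, S.unitN x hx] at h1
    linarith
  have hΓn : ‖Γ‖ ≤ 2 * C / m * r := by
    have h1 := hb.le_dX x hx Γ
    rw [hΓ] at h1
    have h2 := norm_add_le (𝒟[𝒟[S.X]] x v v) (h • S.N x)
    rw [norm_smul, S.unitN x hx, Real.norm_of_nonneg hh0] at h2
    rw [div_mul_eq_mul_div, le_div_iff₀ hm]
    linarith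
  set E := 2 * C ^ 2 / m + C with hE
  have hE0 : 0 < E := by positivity
  have diffBound : ∀ (T : Euc n →L[ℝ] Euc (n + 1)) (T₂ : Euc n →L[ℝ] Euc n →L[ℝ] Euc (n + 1)),
      ‖T‖ ≤ C → ‖T₂‖ ≤ C → ‖T Γ - T₂ v v‖ ≤ E * r := by
    intro T T₂ hT hT₂
    have h1 : ‖T Γ‖ ≤ C * (2 * C / m * r) :=
      (ContinuousLinearMap.le_of_opNorm_le _ hT Γ).trans (by gcongr)
    have h2 := bilin T₂ hT₂
    calc ‖T Γ - T₂ v v‖ ≤ ‖T Γ‖ + ‖T₂ v v‖ := norm_sub_le _ _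
      _ ≤ C * (2 * C / m * r) + C * r := by linarith
      _ = E * r := by rw [hE]; ring
  have hA := diffBound _ _ (hb.dA_le x hx) (hb.ddA_le x hx)
  have hB := diffBound _ _ (hb.dB_le x hx) (hb.ddB_le x hx)
  set α := 𝒟[perturbA S] x Γ - 𝒟[𝒟[perturbA S]] x v v with hα
  set β := 𝒟[perturbB S] x Γ - 𝒟[𝒟[perturbB S]] x v v with hβ
  have hD2 : perturbD2 S t x v v =
      perturbL S t x Γ - h • S.N x - (t • α + t ^ 2 • β) := by
    have h1 : perturbD2 S t x v v = 𝒟[𝒟[S.X]] x v v +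
      (t • 𝒟[𝒟[perturbA S]] x v v + t ^ 2 • 𝒟[𝒟[perturbB S]] x v v) := rfl
    rw [h1, perturbL_apply, hΓ, hα, hβ]
    module
  have hQ : ⟪perturbD2 S t x v v, ν⟫ = -h - ⟪t • α + t ^ 2 • β, ν⟫ := by
    rw [hD2, inner_sub_left, inner_sub_left, hperp, inner_smul_left, hN1]
    simp
  have hαN : ⟪α, S.N x⟫ = ‖𝒟[S.X] x v‖ ^ 2 - h * ⟪S.X x, S.N x⟫ -
      (1 + ‖S.X x‖ ^ 2) / 2 * ‖𝒟[S.N] x v‖ ^ 2 := by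
    rw [hα, inner_sub_left, inner_diskDeriv_perturbA hx, inner_secondDeriv_perturbA hx, hΓ,
      inner_add_right, inner_smul_right]
    ring
  have hβN : -(E * r) ≤ ⟪β, S.N x⟫ := by
    have h1 := (abs_le.1 (abs_real_inner_le_norm β (S.N x))).1
    rw [S.unitN x hx] at h1
    linarith
  have hlast : ⟪t • α + t ^ 2 • β, 𝒟[S.X] x ζ⟫ ≤
      2 * (E * r) * t * (C * (4 * C / m ^ 2 * t)) := by
    refine (real_inner_le_norm _ _).trans ?_
    have h1 := norm_quadratic_le ht.nonneg ht.le_one hA hB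
    have h2 : ‖𝒟[S.X] x ζ‖ ≤ C * (4 * C / m ^ 2 * t) :=
      (ContinuousLinearMap.le_of_opNorm_le _ (hb.dX_le x hx) ζ).trans (by gcongr)
    gcongr
  have hp : h * ⟪S.X x, S.N x⟫ ≤ h * C := by
    have h1 := real_inner_le_norm (S.X x) (S.N x)
    rw [S.unitN x hx, mul_one] at h1
    gcongr
    exact h1.trans (hb.X_le x hx)
  have hq : (1 + ‖S.X x‖ ^ 2) / 2 * ‖𝒟[S.N] x v‖ ^ 2 ≤ (1 + C ^ 2) / 2 * (C / m * h) := by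
    have h1 := hb.norm_deriv_N_sq_le hS hx v
    have h2 := hb.X_le x hx
    gcongr
  have hX : m ^ 2 * r ≤ ‖𝒟[S.X] x v‖ ^ 2 := by
    rw [hr, ← mul_pow]
    have := hb.le_dX x hx v
    gcongr
  have hinner : ⟪t • α + t ^ 2 • β, ν⟫ =
      t * ⟪α, S.N x⟫ + t ^ 2 * ⟪β, S.N x⟫ - ⟪t • α + t ^ 2 • β, 𝒟[S.X] x ζ⟫ := by
    rw [hν, inner_sub_right]
    simp [inner_add_left, inner_smul_left]
  rw [hQ, hinner, hαN]
  have e1 : h * (t * (C + (1 + C ^ 2) / 2 * (C / m))) ≤ h * 1 :=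
    mul_le_mul_of_nonneg_left ht.le_form hh0
  have e2 : t * r * (t * (E * (1 + 8 * C ^ 2 / m ^ 2))) < t * r * m ^ 2 :=
    mul_lt_mul_of_pos_left ht.lt_sq (by positivity)
  have e3 := mul_le_mul_of_nonneg_left hβN (show 0 ≤ t ^ 2 by positivity)
  have e4 := mul_le_mul_of_nonneg_left hp ht.nonneg
  have e5 := mul_le_mul_of_nonneg_left hq ht.nonneg
  have e6 := mul_le_mul_of_nonneg_left hX ht.nonneg
  have e7 : 2 * (E * r) * t * (C * (4 * C / m ^ 2 * t)) =
      t * r * (t * (E * (8 * C ^ 2 / m ^ 2))) := by ring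
  rw [e7] at hlast
  linarith

end Convexity

section Boundary

open scoped Topology

/-- Curves ending on the boundary image of a map of the disk whose differential satisfies
`⟪f' w, u⟫ = β ⟪w, x⟫`, `β ≥ 0`, arrive with velocity pointing to the side of `u`. -/
lemma inner_velocity_nonneg {f : Euc n → Euc (n + 1)} {f' : Euc n →L[ℝ] Euc (n + 1)} {x : Euc n}
    (hx : x ∈ DiskBdry n) (hf : HasFDerivWithinAt f f' (Disk n) x) {a : ℝ} (ha : 0 < a)
    (hanti : ∀ y ∈ Disk n, a * ‖y - x‖ ≤ ‖f y - f x‖) {u : Euc (n + 1)} {β : ℝ} (hβ : 0 ≤ β)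
    (hu : ∀ w, ⟪f' w, u⟫ = β * ⟪w, x⟫) {γ : ℝ → Euc (n + 1)} {ε : ℝ} (hε : 0 < ε)
    (hγ : ∀ s ∈ Icc (-ε) 0, γ s ∈ f '' Disk n) (h0 : γ 0 = f x) {v : Euc (n + 1)}
    (hv : HasDerivWithinAt γ v (Icc (-ε) 0) 0) : 0 ≤ ⟪v, u⟫ := by
  choose! c hc hcγ using hγ
  have hmem : ∀ᶠ s in 𝓝[Icc (-ε) 0] (0 : ℝ), s ∈ Icc (-ε) 0 := self_mem_nhdsWithin
  have hO : (fun s => c s - x) =O[𝓝[Icc (-ε) 0] (0 : ℝ)] fun s => s := by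
    have h1 : (fun s => c s - x) =O[𝓝[Icc (-ε) 0] (0 : ℝ)] fun s => γ s - γ 0 := by
      refine Asymptotics.IsBigO.of_bound a⁻¹ (hmem.mono fun s hs => ?_)
      rw [le_inv_mul_iff₀ ha, h0, ← hcγ s hs]
      exact hanti _ (hc s hs)
    simpa using h1.trans hv.hasFDerivWithinAt.isBigO_sub
  have hid : Tendsto (fun s : ℝ => s) (𝓝[Icc (-ε) 0] (0 : ℝ)) (𝓝 0) :=
    tendsto_id.mono_left nhdsWithin_le_nhds
  have hct : Tendsto c (𝓝[Icc (-ε) 0] (0 : ℝ)) (𝓝[Disk n] x) := by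
    refine tendsto_nhdsWithin_iff.2 ⟨?_, hmem.mono hc⟩
    simpa using (hO.trans_tendsto hid).add_const x
  have ho : (fun s => f (c s) - f x - f' (c s - x)) =o[𝓝[Icc (-ε) 0] (0 : ℝ)] fun s => s :=
    (hf.isLittleO.comp_tendsto hct).trans_isBigO hO
  have hd : (fun s => γ s - γ 0 - (s - 0) • v) =o[𝓝[Icc (-ε) 0] (0 : ℝ)] fun s => s := by
    simpa using hv.hasFDerivWithinAt.isLittleO
  by_contra! hneg
  have hu0 : 0 < ‖u‖ := norm_pos_iff.2 fun h => by simp [h] at hneg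
  have hdiff := (ho.sub hd).def (c := -⟪v, u⟫ / (2 * ‖u‖)) (div_pos (by linarith) (by linarith))
  obtain ⟨s, hs1, hs2, hs3⟩ : ∃ s : ℝ, s < 0 ∧ s ∈ Icc (-ε) 0 ∧
      ‖f (c s) - f x - f' (c s - x) - (γ s - γ 0 - (s - 0) • v)‖ ≤
        -⟪v, u⟫ / (2 * ‖u‖) * ‖s‖ := by
    have hlt : 𝓝[Ioo (-ε) 0] (0 : ℝ) ≤ 𝓝[Icc (-ε) 0] 0 := nhdsWithin_mono _ Ioo_subset_Icc_self
    have : (𝓝[Ioo (-ε) 0] (0 : ℝ)).NeBot := by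
      rw [nhdsWithin_Ioo_eq_nhdsLT (by linarith)]; infer_instance
    obtain ⟨s, h1, h2⟩ := ((hdiff.filter_mono hlt).and
      (self_mem_nhdsWithin : ∀ᶠ s in 𝓝[Ioo (-ε) 0] (0 : ℝ), s ∈ Ioo (-ε) 0)).exists
    exact ⟨s, h2.2, Ioo_subset_Icc_self h2, h1⟩
  rw [hcγ s hs2, h0] at hs3
  have heq : γ s - f x - f' (c s - x) - (γ s - f x - (s - 0) • v) = s • v - f' (c s - x) := by
    rw [sub_zero]; abel
  rw [heq] at hs3
  have h1 := real_inner_le_norm (s • v - f' (c s - x)) u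
  rw [inner_sub_left, inner_smul_left, hu] at h1
  simp only [conj_trivial] at h1
  have h2 : ⟪c s - x, x⟫ ≤ 0 := by
    have hx1 : ‖x‖ = 1 := by simpa [DiskBdry] using hx
    have hc1 : ‖c s‖ ≤ 1 := by simpa [Disk] using hc s hs2
    have := real_inner_le_norm (c s) x
    rw [inner_sub_left, real_inner_self_eq_norm_sq, hx1]
    rw [hx1] at this
    linarith
  have h3 := mul_nonneg_of_nonpos_of_nonpos (neg_nonpos.2 hβ) h2
  have h4 := mul_le_mul_of_nonneg_right hs3 hu0.le
  have h5 : -⟪v, u⟫ / (2 * ‖u‖) * ‖s‖ * ‖u‖ = s * ⟪v, u⟫ / 2 := by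
    rw [Real.norm_of_nonpos hs1.le]; field_simp
  nlinarith [mul_pos_of_neg_of_neg hs1 hneg]

variable {S : HypDisk n} {m C t : ℝ}

lemma PerpFromInside.norm_X (hS : PerpFromInside S) {x : Euc n} (hx : x ∈ DiskBdry n) :
    ‖S.X x‖ = 1 := by simpa using hS.1 x hx

lemma PerpFromInside.inner_X_N (hS : PerpFromInside S) {x : Euc n} (hx : x ∈ DiskBdry n) :
    ⟪S.X x, S.N x⟫ = 0 := by rw [real_inner_comm]; exact hS.2.1 x hx

lemma PerpFromInside.inner_X_deriv_X (hS : PerpFromInside S) {x : Euc n} (hx : x ∈ DiskBdry n)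
    (w : Euc n) : ⟪S.X x, 𝒟[S.X] x w⟫ = ⟪w, x⟫ * ⟪S.X x, 𝒟[S.X] x x⟫ := by
  have hxd := diskBdry_subset_disk hx
  have h := diskDeriv_eq_radial (S.smoothX.inner ℝ S.smoothX) (c := 1)
    (fun y hy => by simp [hS.norm_X hy]) hx w
  rw [diskDeriv_inner S.smoothX S.smoothX hxd, diskDeriv_inner S.smoothX S.smoothX hxd,
    real_inner_comm (S.X x), real_inner_comm (S.X x)] at h
  linarith

lemma PerpFromInside.inner_X_deriv_N (hS : PerpFromInside S) {x : Euc n} (hx : x ∈ DiskBdry n)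
    (w : Euc n) : ⟪S.X x, 𝒟[S.N] x w⟫ = ⟪w, x⟫ * ⟪S.X x, 𝒟[S.N] x x⟫ := by
  have hxd := diskBdry_subset_disk hx
  have h := diskDeriv_eq_radial (S.smoothX.inner ℝ S.smoothN) (c := 0)
    (fun y hy => hS.inner_X_N hy) hx w
  rw [diskDeriv_inner S.smoothX S.smoothN hxd, diskDeriv_inner S.smoothX S.smoothN hxd,
    S.perpN x hxd, S.perpN x hxd] at h
  linarith

lemma PerpFromInside.inner_X_deriv_X_self_nonneg (hS : PerpFromInside S) {x : Euc n}
    (hx : x ∈ DiskBdry n) : 0 ≤ ⟪S.X x, 𝒟[S.X] x x⟫ := by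
  have hx1 : ‖x‖ = 1 := by simpa [DiskBdry] using hx
  have hmaps : MapsTo (fun s : ℝ => x + s • x) (Icc (-1) 0) (Disk n) := by
    intro s hs
    have : x + s • x = (1 + s) • x := by rw [add_smul, one_smul]
    simp only [Disk, mem_closedBall_zero_iff, this, norm_smul, hx1, mul_one, Real.norm_eq_abs,
      abs_le]
    constructor <;> linarith [hs.1, hs.2]
  have hl : HasDerivAt (fun s : ℝ => x + s • x) x 0 := by
    simpa using ((hasDerivAt_id (0 : ℝ)).smul_const x).const_add x
  have hX : HasFDerivWithinAt S.X (𝒟[S.X] x) (Disk n) (x + (0 : ℝ) • x) := by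
    simpa using (S.smoothX.diffWithinAt_disk (diskBdry_subset_disk hx)).hasFDerivWithinAt
  have hd := hX.comp_hasDerivWithinAt (0 : ℝ) hl.hasDerivWithinAt hmaps
  have h := hS.2.2 (fun s => S.X (x + s • x)) 1 one_pos
    ((S.smoothX.of_le (by norm_cast)).comp
      (contDiff_const.add (contDiff_id.smul contDiff_const)).contDiffOn hmaps)
    (fun s hs => ⟨_, hmaps hs, rfl⟩) ⟨x, hx, by simp⟩ _ hd
  simpa [real_inner_comm] using h

/-- The conormal is a principal direction along the boundary. -/
lemma DiskBounds.exists_conormal (hb : DiskBounds S m C) (hS : PerpFromInside S) {x : Euc n}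
    (hx : x ∈ DiskBdry n) : ∃ (w : Euc n) (κ : ℝ), 𝒟[S.X] x w = S.X x ∧
      𝒟[S.N] x w = κ • S.X x ∧ κ ≤ C / m ∧
      ∀ v, ⟪S.X x, 𝒟[S.N] x v⟫ = κ * ⟪S.X x, 𝒟[S.X] x v⟫ := by
  have hm := hb.m_pos
  have hC := hb.C_pos
  have hxd := diskBdry_subset_disk hx
  obtain ⟨w, hw⟩ := S.exists_deriv_eq hxd (hS.inner_X_N hx)
  have hXX : ⟪S.X x, S.X x⟫ = 1 := by simp [hS.norm_X hx]
  set κ := ⟪S.X x, 𝒟[S.N] x w⟫ with hκ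
  have hwx := hS.inner_X_deriv_X hx w
  rw [hw, hXX] at hwx
  have hX : ∀ v, ⟪S.X x, 𝒟[S.N] x v⟫ = κ * ⟪S.X x, 𝒟[S.X] x v⟫ := by
    intro v
    rw [hκ, hS.inner_X_deriv_N hx w, hS.inner_X_deriv_N hx v, hS.inner_X_deriv_X hx v]
    linear_combination ⟪v, x⟫ * ⟪S.X x, 𝒟[S.N] x x⟫ * hwx
  refine ⟨w, κ, hw, ?_, ?_, hX⟩
  · obtain ⟨v, hv⟩ := S.exists_deriv_eq hxd (y := 𝒟[S.N] x w - κ • S.X x) (by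
      rw [inner_sub_left, inner_smul_left, hS.inner_X_N hx, real_inner_comm,
        S.inner_deriv_N hxd]; simp)
    rw [← sub_eq_zero, ← inner_self_eq_zero (𝕜 := ℝ)]
    nth_rw 1 [← hv]
    rw [inner_sub_right, inner_smul_right, S.inner_weingarten_symm hxd, hw, hX,
      real_inner_comm (S.X x), sub_self]
  · have h1 := hb.le_dX x hxd w
    rw [hw, hS.norm_X hx] at h1
    have h2 := real_inner_le_norm (S.X x) (𝒟[S.N] x w)
    rw [hS.norm_X hx, one_mul] at h2
    refine h2.trans ((ContinuousLinearMap.le_of_opNorm_le _ (hb.dN_le x hxd) w).trans ?_)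
    rw [le_div_iff₀ hm]
    nlinarith

lemma PerpFromInside.perturbX_eq (hS : PerpFromInside S) (t : ℝ) {x : Euc n}
    (hx : x ∈ DiskBdry n) : perturbX S t x = perturbScale t • (S.X x - t • S.N x) := by
  simp only [perturbX, perturbA, perturbB, hS.norm_X hx, hS.inner_X_N hx]
  norm_num [sub_eq_add_neg]

lemma PerpFromInside.norm_sub_smul_sq (hS : PerpFromInside S) (t : ℝ) {x : Euc n}
    (hx : x ∈ DiskBdry n) : ‖S.X x - t • S.N x‖ ^ 2 = 1 + t ^ 2 := by
  rw [norm_sub_sq_real, inner_smul_right, hS.inner_X_N hx, hS.norm_X hx, norm_smul,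
    S.unitN x (diskBdry_subset_disk hx)]
  simp

lemma PerpFromInside.norm_perturbX (hS : PerpFromInside S) (t : ℝ) {x : Euc n}
    (hx : x ∈ DiskBdry n) : ‖perturbX S t x‖ = 1 := by
  rw [hS.perturbX_eq t hx, norm_smul, Real.norm_of_nonneg (perturbScale_pos t).le,
    ← sq_eq_sq₀ (by have := perturbScale_pos t; positivity) zero_le_one, mul_pow,
    hS.norm_sub_smul_sq t hx, perturbScale_sq_mul, one_pow]

lemma PerpFromInside.perturbL_eq (hS : PerpFromInside S) (t : ℝ) {x : Euc n}
    (hx : x ∈ DiskBdry n) (w : Euc n) :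
    perturbL S t x w = 𝒟[S.X] x w - t • 𝒟[S.N] x w -
      (t * (⟪S.X x, 𝒟[S.X] x w⟫ - t * ⟪S.X x, 𝒟[S.N] x w⟫)) • S.N x := by
  have hxd := diskBdry_subset_disk hx
  rw [perturbL_apply, diskDeriv_perturbA hxd, diskDeriv_perturbB hxd, S.perpN x hxd,
    hS.norm_X hx, hS.inner_X_N hx]
  norm_num
  module

/-- The perturbed hypersurface meets the sphere orthogonally. -/
lemma DiskBounds.inner_perturbNu_perturbX (hb : DiskBounds S m C) (hS : PerpFromInside S)
    (ht : IsSmallParam m C t) {x : Euc n} (hx : x ∈ DiskBdry n) :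
    ⟪perturbNu S t x, perturbX S t x⟫ = 0 := by
  have hm := hb.m_pos
  have hxd := diskBdry_subset_disk hx
  obtain ⟨w, κ, hw, hκ, hκle, -⟩ := hb.exists_conormal hS hx
  obtain ⟨ζ, -, -, hperp⟩ := hb.exists_perturbNu_eq ht.nonneg ht.le_one ht.le_m hxd
  have h := hperp w
  have hL : perturbL S t x w = (1 - t * κ) • (S.X x - t • S.N x) := by
    rw [hS.perturbL_eq t hx, hw, hκ, inner_smul_right, real_inner_self_eq_norm_sq, hS.norm_X hx]
    norm_num
    module
  have hlt : 0 < 1 - t * κ := by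
    have h1 := mul_le_mul_of_nonneg_left hκle ht.nonneg
    have h2 : t * (C / m) ≤ 1 / 4 := by
      rw [← mul_div_assoc, div_le_iff₀ hm]; linarith [ht.le_m]
    linarith
  rw [hL, inner_smul_left] at h
  have h0 := (mul_eq_zero.1 h).resolve_left (by simpa using hlt.ne')
  rw [hS.perturbX_eq t hx, inner_smul_right, real_inner_comm, h0, mul_zero]

lemma DiskBounds.exists_inner_perturbX (hb : DiskBounds S m C) (hS : PerpFromInside S)
    (ht : IsSmallParam m C t) {x : Euc n} (hx : x ∈ DiskBdry n) :
    ∃ β, 0 ≤ β ∧ ∀ w, ⟪𝒟[perturbX S t] x w, perturbX S t x⟫ = β * ⟪w, x⟫ := by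
  have hm := hb.m_pos
  have hxd := diskBdry_subset_disk hx
  obtain ⟨w, κ, hw, hκ, hκle, hN⟩ := hb.exists_conormal hS hx
  have hlt : 0 < 1 - t * κ := by
    have h1 := mul_le_mul_of_nonneg_left hκle ht.nonneg
    have h2 : t * (C / m) ≤ 1 / 4 := by
      rw [← mul_div_assoc, div_le_iff₀ hm]; linarith [ht.le_m]
    linarith
  have hnn := hS.inner_X_deriv_X_self_nonneg hx
  refine ⟨(1 - t * κ) * ⟪S.X x, 𝒟[S.X] x x⟫, by positivity, fun w => ?_⟩
  have hNN : ⟪S.N x, S.N x⟫ = 1 := by simp [S.unitN x hxd]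
  rw [diskDeriv_perturbX S t hxd, smul_apply, hS.perturbL_eq t hx, hS.perturbX_eq t hx]
  simp only [inner_smul_left, inner_smul_right, inner_sub_left, inner_sub_right, conj_trivial,
    hNN, S.perpN x hxd, hS.2.1 x hx, real_inner_comm (S.N x) (𝒟[S.N] x w), S.inner_deriv_N hxd,
    real_inner_comm (S.X x) (𝒟[S.N] x w), hN, real_inner_comm (S.X x) (𝒟[S.X] x w),
    hS.inner_X_deriv_X hx w]
  linear_combination ((1 - t * κ) * ⟪S.X x, 𝒟[S.X] x x⟫ * ⟪w, x⟫) * perturbScale_sq_mul t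

end Boundary

section PerturbedDisk

variable {S : HypDisk n} {m C t : ℝ}

lemma DiskBounds.dist_sub_le (hb : DiskBounds S m C) (ht : IsSmallParam m C t) {x y : Euc n}
    (hx : x ∈ Disk n) (hy : y ∈ Disk n) :
    ‖(t • perturbA S x + t ^ 2 • perturbB S x) - (t • perturbA S y + t ^ 2 • perturbB S y)‖ ≤
      2 * C * t / m * ‖S.X x - S.X y‖ := by
  have hm := hb.m_pos
  have hC := hb.C_pos
  have ht0 := ht.nonneg
  refine (hb.dist_perturb_le ht.nonneg ht.le_one hx hy).trans ?_
  have := mul_le_mul_of_nonneg_left (hb.le_dist x hx y hy) (show 0 ≤ 2 * C * t / m by positivity)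
  rwa [show 2 * C * t / m * (m * ‖x - y‖) = 2 * C * t * ‖x - y‖ by field_simp] at this

lemma perturbX_sub (S : HypDisk n) (t : ℝ) (x y : Euc n) : perturbX S t x - perturbX S t y =
    perturbScale t • ((S.X x - S.X y) + ((t • perturbA S x + t ^ 2 • perturbB S x) -
      (t • perturbA S y + t ^ 2 • perturbB S y))) := by
  simp only [perturbX, ← smul_sub]
  congr 1
  abel

lemma DiskBounds.norm_perturbX_sub_le (hb : DiskBounds S m C) (ht : IsSmallParam m C t)
    {x y : Euc n} (hx : x ∈ Disk n) (hy : y ∈ Disk n) :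
    ‖perturbX S t x - perturbX S t y‖ ≤
      perturbScale t * (1 + 2 * C * t / m) * ‖S.X x - S.X y‖ := by
  rw [perturbX_sub, norm_smul, Real.norm_of_nonneg (perturbScale_pos t).le, mul_assoc]
  have := perturbScale_pos t
  gcongr
  linarith [hb.dist_sub_le ht hx hy, norm_add_le (S.X x - S.X y)
    ((t • perturbA S x + t ^ 2 • perturbB S x) - (t • perturbA S y + t ^ 2 • perturbB S y))]

lemma DiskBounds.le_norm_perturbX_sub (hb : DiskBounds S m C) (ht : IsSmallParam m C t)
    {x y : Euc n} (hx : x ∈ Disk n) (hy : y ∈ Disk n) :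
    perturbScale t * (1 - 2 * C * t / m) * ‖S.X x - S.X y‖ ≤
      ‖perturbX S t x - perturbX S t y‖ := by
  rw [perturbX_sub, norm_smul, Real.norm_of_nonneg (perturbScale_pos t).le, mul_assoc]
  have := perturbScale_pos t
  gcongr
  have h := norm_sub_norm_le (S.X x - S.X y)
    (-((t • perturbA S x + t ^ 2 • perturbB S x) - (t • perturbA S y + t ^ 2 • perturbB S y)))
  rw [norm_neg, sub_neg_eq_add] at h
  linarith [hb.dist_sub_le ht hx hy]

lemma DiskBounds.ratio_le (hb : DiskBounds S m C) (ht : IsSmallParam m C t) :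
    2 * C * t / m ≤ 1 / 2 := by
  rw [div_le_iff₀ hb.m_pos]; linarith [ht.le_m]

lemma DiskBounds.antilipschitz_perturbX (hb : DiskBounds S m C) (ht : IsSmallParam m C t)
    {x y : Euc n} (hx : x ∈ Disk n) (hy : y ∈ Disk n) :
    perturbScale t * (m / 2) * ‖x - y‖ ≤ ‖perturbX S t x - perturbX S t y‖ := by
  refine le_trans ?_ (hb.le_norm_perturbX_sub ht hx hy)
  have h1 := hb.ratio_le ht
  have h2 := perturbScale_pos t
  have h3 := hb.le_dist x hx y hy
  have h4 := hb.m_pos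
  calc perturbScale t * (m / 2) * ‖x - y‖ = perturbScale t * (1 - 1 / 2) * (m * ‖x - y‖) := by ring
    _ ≤ _ := mul_le_mul (mul_le_mul_of_nonneg_left (by linarith) h2.le) h3 (by positivity)
      (mul_nonneg h2.le (by linarith))

/-- The perturbed hypersurface. -/
def perturbDisk (hb : DiskBounds S m C) (ht : IsSmallParam m C t) : HypDisk n where
  X := perturbX S t
  N := perturbN S t
  smoothX := smooth_perturbX S t
  smoothN := by
    have h := smooth_perturbNu S fun x hx => hb.isUnit_perturbK ht.nonneg ht.le_one ht.le_m hx
    have hne : ∀ x ∈ Disk n, perturbNu S t x ≠ 0 := fun x hx =>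
      hb.perturbNu_ne_zero ht.nonneg ht.le_one ht.le_m hx
    exact ((h.norm ℝ hne).inv fun x hx => norm_ne_zero_iff.2 (hne x hx)).smul h
  injX := by
    intro x hx y hy hxy
    have h := hb.antilipschitz_perturbX ht hx hy
    rw [hxy, sub_self, norm_zero] at h
    have h1 := perturbScale_pos t
    have h2 := hb.m_pos
    by_contra hne
    have h3 : 0 < ‖x - y‖ := norm_sub_pos_iff.2 hne
    have : 0 < perturbScale t * (m / 2) * ‖x - y‖ := by positivity
    linarith
  immersion := by
    intro x hx
    rw [injective_iff_map_eq_zero]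
    intro w hw
    rw [diskDeriv_perturbX S t hx, smul_apply,
      smul_eq_zero_iff_right (perturbScale_pos t).ne'] at hw
    have h := hb.coercive ht.nonneg ht.le_one ht.le_m hx w
    rw [hw, inner_zero_left] at h
    have := hb.m_pos
    by_contra hne
    have : 0 < ‖w‖ := norm_pos_iff.2 hne
    have : 0 < m ^ 2 / 2 * ‖w‖ ^ 2 := by positivity
    linarith
  unitN := by
    intro x hx
    exact norm_smul_inv_norm (𝕜 := ℝ) (hb.perturbNu_ne_zero ht.nonneg ht.le_one ht.le_m hx)
  perpN := by
    intro x hx w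
    obtain ⟨ζ, -, -, h⟩ := hb.exists_perturbNu_eq ht.nonneg ht.le_one ht.le_m hx
    rw [diskDeriv_perturbX S t hx, smul_apply, perturbN, inner_smul_left, inner_smul_right, h]
    simp

lemma perturbDisk_strictlyConvex (hb : DiskBounds S m C) (ht : IsSmallParam m C t)
    (hS : WeaklyConvex S) (ht0 : 0 < t) : StrictlyConvex (perturbDisk hb ht) := by
  intro x hx
  refine sff_posDef_of _ hx fun v hv => ?_
  change ⟪𝒟[𝒟[perturbX S t]] x v v, perturbN S t x⟫ < 0
  rw [diskDeriv_deriv_perturbX S t hx, smul_apply, smul_apply, perturbN, inner_smul_left,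
    inner_smul_right, conj_trivial]
  have h1 := norm_pos_iff.2 (hb.perturbNu_ne_zero ht.nonneg ht.le_one ht.le_m hx)
  exact mul_neg_of_pos_of_neg (perturbScale_pos t) (mul_neg_of_pos_of_neg (inv_pos.2 h1)
    (hb.perturbD2_inner_neg hS ht ht0 hx hv))

lemma perturbDisk_perpFromInside (hb : DiskBounds S m C) (ht : IsSmallParam m C t)
    (hS : PerpFromInside S) : PerpFromInside (perturbDisk hb ht) := by
  refine ⟨fun x hx => mem_sphere_zero_iff_norm.2 (hS.norm_perturbX t hx), fun x hx => ?_, ?_⟩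
  · change ⟪perturbN S t x, perturbX S t x⟫ = 0
    rw [perturbN, inner_smul_left, hb.inner_perturbNu_perturbX hS ht hx, mul_zero]
  · rintro γ ε hε - hγ ⟨x, hx, hγ0⟩ v hv
    have hxd := diskBdry_subset_disk hx
    obtain ⟨β, hβ, h⟩ := hb.exists_inner_perturbX hS ht hx
    rw [← hγ0]
    exact inner_velocity_nonneg hx ((smooth_perturbX S t).diffWithinAt_disk hxd).hasFDerivWithinAt
      (a := perturbScale t * (m / 2)) (mul_pos (perturbScale_pos t) (half_pos hb.m_pos))
      (fun y hy => hb.antilipschitz_perturbX ht hy hxd) hβ h hε hγ hγ0.symm hv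

end PerturbedDisk

section Area

open scoped Topology

variable {α E : Type*} [NormedAddCommGroup E] [MeasurableSpace E] [BorelSpace E]

lemma hausdorffMeasure_image_le_of_norm_sub_le {f g : α → E} {s : Set α} {K : ℝ≥0} {d : ℝ}
    (hd : 0 ≤ d) (h : ∀ x ∈ s, ∀ y ∈ s, ‖g x - g y‖ ≤ K * ‖f x - f y‖) :
    μH[d] (g '' s) ≤ (K : ℝ≥0∞) ^ d * μH[d] (f '' s) := by
  rcases s.eq_empty_or_nonempty with rfl | ⟨x₀, -⟩
  · simp
  have : Nonempty α := ⟨x₀⟩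
  have hinv : ∀ x ∈ s, Function.invFunOn f s (f x) ∈ s ∧
      f (Function.invFunOn f s (f x)) = f x := fun x hx =>
    ⟨Function.invFunOn_mem ⟨x, hx, rfl⟩, Function.invFunOn_eq ⟨x, hx, rfl⟩⟩
  have hg : ∀ x ∈ s, g (Function.invFunOn f s (f x)) = g x := fun x hx => by
    have := h _ (hinv x hx).1 x hx
    rw [(hinv x hx).2, sub_self, norm_zero, mul_zero] at this
    exact sub_eq_zero.1 (norm_le_zero_iff.1 this)
  have hL : LipschitzOnWith K (g ∘ Function.invFunOn f s) (f '' s) := by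
    refine LipschitzOnWith.of_dist_le_mul ?_
    rintro _ ⟨x, hx, rfl⟩ _ ⟨y, hy, rfl⟩
    simpa [dist_eq_norm, hg x hx, hg y hy] using h x hx y hy
  have himg : (g ∘ Function.invFunOn f s) '' (f '' s) = g '' s := by
    rw [image_image]
    exact image_congr hg
  rw [← himg]
  exact hL.hausdorffMeasure_image_le hd

/-- Hausdorff measures of images depend continuously on the map with respect to bi-Lipschitz
closeness. -/
lemma tendsto_hausdorffMeasure_image {f : α → E} {g : ℝ → α → E} {s : Set α} {d : ℝ}
    (hd : 0 ≤ d) {l : Filter ℝ} {K K' : ℝ → ℝ} (hK : Tendsto K l (𝓝 1)) (hK' : Tendsto K' l (𝓝 1))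
    (h : ∀ᶠ t in l, ∀ x ∈ s, ∀ y ∈ s, ‖g t x - g t y‖ ≤ K t * ‖f x - f y‖)
    (h' : ∀ᶠ t in l, ∀ x ∈ s, ∀ y ∈ s, K' t * ‖f x - f y‖ ≤ ‖g t x - g t y‖) :
    Tendsto (fun t => (μH[d] (g t '' s)).toReal) l (𝓝 (μH[d] (f '' s)).toReal) := by
  have hpos : ∀ᶠ t in l, 0 < K t := hK.eventually (lt_mem_nhds one_pos)
  have hpos' : ∀ᶠ t in l, 0 < K' t := hK'.eventually (lt_mem_nhds one_pos)
  have hle : ∀ᶠ t in l, μH[d] (g t '' s) ≤ ((K t).toNNReal : ℝ≥0∞) ^ d * μH[d] (f '' s) := by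
    filter_upwards [h, hpos] with t ht htp
    refine hausdorffMeasure_image_le_of_norm_sub_le hd ?_
    simpa [htp.le] using ht
  have hge : ∀ᶠ t in l,
      μH[d] (f '' s) ≤ (((K' t)⁻¹).toNNReal : ℝ≥0∞) ^ d * μH[d] (g t '' s) := by
    filter_upwards [h', hpos'] with t ht htp
    refine hausdorffMeasure_image_le_of_norm_sub_le hd fun x hx y hy => ?_
    rw [Real.coe_toNNReal _ (inv_pos.2 htp).le, le_inv_mul_iff₀ htp]
    exact ht x hx y hy
  rcases eq_or_ne (μH[d] (f '' s)) ⊤ with htop | hfin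
  · refine tendsto_const_nhds.congr' ?_
    filter_upwards [hge] with t ht
    rw [htop, top_le_iff, ENNReal.mul_eq_top] at ht
    rw [htop]
    rcases ht with ht | ht
    · rw [ht.2]
    · exact absurd ht.1 (ENNReal.rpow_ne_top_of_nonneg hd ENNReal.coe_ne_top)
  · have hpow : ∀ {F : ℝ → ℝ}, Tendsto F l (𝓝 1) → Tendsto (fun t => F t ^ d) l (𝓝 1) := by
      intro F hF
      simpa using hF.rpow_const (p := d) (Or.inl one_ne_zero)
    have hlow := (hpow hK').mul_const (μH[d] (f '' s)).toReal
    have hup := (hpow hK).mul_const (μH[d] (f '' s)).toReal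
    rw [one_mul] at hlow hup
    refine tendsto_of_tendsto_of_tendsto_of_le_of_le' hlow hup ?_ ?_
    · filter_upwards [hge, hle, hpos'] with t ht ht2 htp
      have hfin' : μH[d] (g t '' s) ≠ ⊤ := ne_top_of_le_ne_top
        (ENNReal.mul_ne_top (ENNReal.rpow_ne_top_of_nonneg hd ENNReal.coe_ne_top) hfin) ht2
      have h1 := ENNReal.toReal_mono (ENNReal.mul_ne_top
        (ENNReal.rpow_ne_top_of_nonneg hd ENNReal.coe_ne_top) hfin') ht
      rw [ENNReal.toReal_mul, ← ENNReal.toReal_rpow, ENNReal.coe_toReal,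
        Real.coe_toNNReal _ (inv_pos.2 htp).le, Real.inv_rpow htp.le,
        le_inv_mul_iff₀ (Real.rpow_pos_of_pos htp d)] at h1
      exact h1
    · filter_upwards [hle, hpos] with t ht htp
      have h1 := ENNReal.toReal_mono (ENNReal.mul_ne_top
        (ENNReal.rpow_ne_top_of_nonneg hd ENNReal.coe_ne_top) hfin) ht
      rwa [ENNReal.toReal_mul, ← ENNReal.toReal_rpow, ENNReal.coe_toReal,
        Real.coe_toNNReal _ htp.le] at h1

/-- Areas of the perturbations of parts of the hypersurface converge. -/
lemma DiskBounds.tendsto_hausdorffMeasure {S : HypDisk n} {m C ε : ℝ} (hb : DiskBounds S m C)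
    (hε : ∀ t ∈ Ioo 0 ε, IsSmallParam m C t) {s : Set (Euc n)} (hs : s ⊆ Disk n) {d : ℝ}
    (hd : 0 ≤ d) :
    Tendsto (fun t => (μH[d] (perturbX S t '' s)).toReal) (𝓝[Ioo 0 ε] 0)
      (𝓝 (μH[d] (S.X '' s)).toReal) := by
  have h0 : ∀ c : ℝ, Tendsto (fun t => perturbScale t * (1 + c * t / m)) (𝓝[Ioo 0 ε] 0)
      (𝓝 1) := by
    intro c
    have : Continuous fun t => perturbScale t * (1 + c * t / m) :=
      continuous_perturbScale.mul (by fun_prop)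
    have h := this.tendsto 0
    simp only [perturbScale_zero, mul_zero, zero_div, add_zero, one_mul] at h
    exact h.mono_left nhdsWithin_le_nhds
  refine tendsto_hausdorffMeasure_image hd (h0 (2 * C)) (h0 (-(2 * C))) ?_ ?_
  · filter_upwards [self_mem_nhdsWithin] with t ht x hx y hy
    exact hb.norm_perturbX_sub_le (hε t ht) (hs hx) (hs hy)
  · filter_upwards [self_mem_nhdsWithin] with t ht x hx y hy
    have := hb.le_norm_perturbX_sub (hε t ht) (hs hx) (hs hy)
    rwa [neg_mul, neg_div, ← sub_eq_add_neg]

end Area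

section Integral

open scoped Topology

lemma continuousOn_setIntegral_of_compact {X E : Type*} [TopologicalSpace X] [T2Space X]
    [MeasurableSpace X] [OpensMeasurableSpace X] [SecondCountableTopology X]
    [NormedAddCommGroup E] [NormedSpace ℝ E] {μ : Measure X} [IsFiniteMeasureOnCompacts μ]
    {F : ℝ × X → E} {s : Set ℝ} {k : Set X} (hs : IsCompact s) (hk : IsCompact k)
    (hF : ContinuousOn F (s ×ˢ k)) : ContinuousOn (fun t => ∫ x in k, F (t, x) ∂μ) s := by
  obtain ⟨M, hM⟩ := (hs.prod hk).exists_bound_of_continuousOn hF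
  have hslice : ∀ t ∈ s, ContinuousOn (fun x => F (t, x)) k := fun t ht =>
    hF.comp (by fun_prop) fun x hx => ⟨ht, hx⟩
  intro t ht
  refine continuousWithinAt_of_dominated (bound := fun _ => M) ?_ ?_ ?_ ?_
  · filter_upwards [self_mem_nhdsWithin] with u hu
    exact (hslice u hu).aestronglyMeasurable_of_isCompact hk hk.measurableSet
  · filter_upwards [self_mem_nhdsWithin] with u hu
    exact (ae_restrict_iff' hk.measurableSet).2 (ae_of_all _ fun x hx => hM _ ⟨hu, hx⟩)
  · exact integrableOn_const hk.measure_ne_top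
  · refine (ae_restrict_iff' hk.measurableSet).2 (ae_of_all _ fun x hx => ?_)
    exact (hF (t, x) ⟨ht, hx⟩).comp (f := fun u => (u, x)) (by fun_prop) fun u hu => ⟨hu, hx⟩

lemma ContinuousOn.trace_inv_mul_sq_mul_sqrt_det {X : Type*} [TopologicalSpace X]
    {G H : X → Matrix (Fin n) (Fin n) ℝ} {s : Set X} (hG : ContinuousOn G s)
    (hH : ContinuousOn H s) (hne : ∀ z ∈ s, (G z).det ≠ 0) :
    ContinuousOn (fun z => ((G z)⁻¹ * H z).trace ^ 2 * √(G z).det) s := by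
  have hdet : ContinuousOn (fun z => (G z).det) s := continuous_id.matrix_det.comp_continuousOn hG
  have hadj : ContinuousOn (fun z => (G z).adjugate) s :=
    continuous_id.matrix_adjugate.comp_continuousOn hG
  have hinv : ContinuousOn (fun z => (G z)⁻¹) s := by
    simp only [Matrix.inv_def, Ring.inverse_eq_inv']
    exact (hdet.inv₀ hne).smul hadj
  have hmul : Continuous fun p : Matrix (Fin n) (Fin n) ℝ × Matrix (Fin n) (Fin n) ℝ =>
      (p.1 * p.2).trace := (continuous_fst.matrix_mul continuous_snd).matrix_trace
  exact ((hmul.comp_continuousOn (hinv.prodMk hH)).pow 2).mul hdet.sqrt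

variable {S : HypDisk n} {m C t ε : ℝ}

/-- The metric of the perturbed hypersurface. -/
def perturbGmet (S : HypDisk n) (z : ℝ × Euc n) : Matrix (Fin n) (Fin n) ℝ :=
  Matrix.of fun i j =>
    ⟪perturbScale z.1 • perturbL S z.1 z.2 (EuclideanSpace.single i 1),
      perturbScale z.1 • perturbL S z.1 z.2 (EuclideanSpace.single j 1)⟫

/-- The second fundamental form of the perturbed hypersurface. -/
def perturbSff (S : HypDisk n) (z : ℝ × Euc n) : Matrix (Fin n) (Fin n) ℝ :=
  Matrix.of fun i j =>
    -⟪perturbScale z.1 • perturbD2 S z.1 z.2 (EuclideanSpace.single j 1)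
        (EuclideanSpace.single i 1), perturbN S z.1 z.2⟫

/-- The integrand of the Willmore-type energy of the perturbed hypersurface. -/
def perturbDensity (S : HypDisk n) (z : ℝ × Euc n) : ℝ :=
  ((perturbGmet S z)⁻¹ * perturbSff S z).trace ^ 2 * √(perturbGmet S z).det

lemma gmet_perturbDisk (hb : DiskBounds S m C) (ht : IsSmallParam m C t) {x : Euc n}
    (hx : x ∈ Disk n) : gmet (perturbDisk hb ht) x = perturbGmet S (t, x) := by
  ext i j
  change ⟪𝒟[perturbX S t] x _, 𝒟[perturbX S t] x _⟫ = _
  rw [diskDeriv_perturbX S t hx]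
  rfl

lemma sff_perturbDisk (hb : DiskBounds S m C) (ht : IsSmallParam m C t) {x : Euc n}
    (hx : x ∈ Disk n) : sff (perturbDisk hb ht) x = perturbSff S (t, x) := by
  ext i j
  rw [sff_apply _ hx]
  change -⟪𝒟[𝒟[perturbX S t]] x _ _, perturbN S t x⟫ = _
  rw [diskDeriv_deriv_perturbX S t hx]
  rfl

lemma surfIntegral_perturbDisk (hb : DiskBounds S m C) (ht : IsSmallParam m C t) :
    surfIntegral (perturbDisk hb ht) (fun x => meanCurv (perturbDisk hb ht) x ^ 2) =
      ∫ x in Disk n, perturbDensity S (t, x) := by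
  refine setIntegral_congr_fun isCompact_disk.measurableSet fun x hx => ?_
  simp only [meanCurv, gmet_perturbDisk hb ht hx, sff_perturbDisk hb ht hx, perturbDensity]

lemma DiskBounds.surfIntegral_eq (hb : DiskBounds S m C) (h0 : IsSmallParam m C 0) :
    surfIntegral S (fun x => meanCurv S x ^ 2) = ∫ x in Disk n, perturbDensity S (0, x) := by
  refine setIntegral_congr_fun isCompact_disk.measurableSet fun x hx => ?_
  have hL : perturbL S 0 x = 𝒟[S.X] x := by
    ext1 w
    simp [perturbL_apply]
  have hD : perturbD2 S 0 x = 𝒟[𝒟[S.X]] x := by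
    ext1 w
    ext1 v
    simp [perturbD2]
  have hN : perturbN S 0 x = S.N x := by
    obtain ⟨ζ, h1, h2, -⟩ := hb.exists_perturbNu_eq h0.nonneg h0.le_one h0.le_m hx
    rw [mul_zero, norm_le_zero_iff] at h2
    rw [h2, map_zero, sub_zero] at h1
    rw [perturbN, h1, S.unitN x hx, inv_one, one_smul]
  have hg : gmet S x = perturbGmet S (0, x) := by
    ext i j
    simp [gmet, perturbGmet, hL, perturbScale_zero]
  have hs : sff S x = perturbSff S (0, x) := by
    ext i j
    simp [sff_apply S hx, perturbSff, hD, hN, perturbScale_zero]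
  simp only [meanCurv, hg, hs, perturbDensity]

lemma DiskBounds.continuousOn_perturbDensity (hb : DiskBounds S m C)
    (hε : ∀ t ∈ Icc 0 ε, IsSmallParam m C t) :
    ContinuousOn (perturbDensity S) (Icc 0 ε ×ˢ Disk n) := by
  have hc : ContinuousOn (fun z : ℝ × Euc n => perturbScale z.1) (Icc 0 ε ×ˢ Disk n) :=
    (continuous_perturbScale.comp continuous_fst).continuousOn
  have hL := continuousOn_uncurry_perturbL S (Icc 0 ε)
  have hD := continuousOn_uncurry_perturbD2 S (Icc 0 ε)
  have hν := continuousOn_uncurry_perturbNu S (s := Icc 0 ε) fun t ht x hx =>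
    hb.isUnit_perturbK (hε t ht).nonneg (hε t ht).le_one (hε t ht).le_m hx
  have hN : ContinuousOn (fun z : ℝ × Euc n => perturbN S z.1 z.2) (Icc 0 ε ×ˢ Disk n) :=
    (hν.norm.inv₀ fun z hz => norm_ne_zero_iff.2 (hb.perturbNu_ne_zero (hε _ hz.1).nonneg
      (hε _ hz.1).le_one (hε _ hz.1).le_m hz.2)).smul hν
  have hG : ContinuousOn (perturbGmet S) (Icc 0 ε ×ˢ Disk n) := by
    refine continuousOn_pi.2 fun i => continuousOn_pi.2 fun j => ?_
    exact (hc.smul (hL.clm_apply continuousOn_const)).inner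
      (hc.smul (hL.clm_apply continuousOn_const))
  have hH : ContinuousOn (perturbSff S) (Icc 0 ε ×ˢ Disk n) := by
    refine continuousOn_pi.2 fun i => continuousOn_pi.2 fun j => ?_
    exact ((hc.smul ((hD.clm_apply continuousOn_const).clm_apply continuousOn_const)).inner
      hN).neg
  refine hG.trace_inv_mul_sq_mul_sqrt_det hH fun z hz => ?_
  rw [← gmet_perturbDisk hb (hε _ hz.1) hz.2]
  exact (gmet_det_pos _ hz.2).ne'

lemma DiskBounds.tendsto_integral_perturbDensity (hb : DiskBounds S m C) (hε0 : 0 < ε)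
    (hε : ∀ t ∈ Icc 0 ε, IsSmallParam m C t) :
    Tendsto (fun t => ∫ x in Disk n, perturbDensity S (t, x)) (𝓝[Ioo 0 ε] 0)
      (𝓝 (surfIntegral S (fun x => meanCurv S x ^ 2))) := by
  have h0 : (0 : ℝ) ∈ Icc 0 ε := ⟨le_rfl, hε0.le⟩
  rw [hb.surfIntegral_eq (hε 0 h0)]
  exact ((continuousOn_setIntegral_of_compact isCompact_Icc isCompact_disk
    (hb.continuousOn_perturbDensity hε)) 0 h0).mono_left (nhdsWithin_mono _ Ioo_subset_Icc_self)

end Integral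

/-- A weakly convex embedded `n`-disk `M` perpendicular to `S^n` from the inside
whose boundary is not an equator can be approximated by smooth strictly convex hypersurfaces
`M_t`, `0 < t < ε`, perpendicular to `S^n` from the inside, with
`∫_{M_t} H² dμ_t → ∫_M H² dμ`, `|M_t| → |M|` and `|∂M_t| → |∂M|` as `t → 0`. -/
theorem approximation_by_strictly_convex (n : ℕ) (S : HypDisk n)
    (hconv : WeaklyConvex S) (hperp : PerpFromInside S)
    (hne : ¬ IsEquator (S.X '' DiskBdry n)) :
    ∃ ε : ℝ, 0 < ε ∧ ∃ Mt : ℝ → HypDisk n,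
      (∀ t ∈ Set.Ioo (0 : ℝ) ε, StrictlyConvex (Mt t) ∧ PerpFromInside (Mt t)) ∧
      Filter.Tendsto (fun t => surfIntegral (Mt t) (fun x => meanCurv (Mt t) x ^ 2))
        (nhdsWithin 0 (Set.Ioo (0 : ℝ) ε)) (nhds (surfIntegral S (fun x => meanCurv S x ^ 2))) ∧
      Filter.Tendsto (fun t => area (Mt t))
        (nhdsWithin 0 (Set.Ioo (0 : ℝ) ε)) (nhds (area S)) ∧
      Filter.Tendsto (fun t => bdryArea (Mt t))
        (nhdsWithin 0 (Set.Ioo (0 : ℝ) ε)) (nhds (bdryArea S)) := by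
  rcases n.eq_zero_or_pos with rfl | hn
  · exact ⟨1, one_pos, fun _ => S, fun t _ =>
      ⟨fun x hx => sff_posDef_of S hx fun v hv => absurd (Subsingleton.elim v 0) hv, hperp⟩,
      tendsto_const_nhds, tendsto_const_nhds, tendsto_const_nhds⟩
  obtain ⟨m, C, hb⟩ := S.exists_diskBounds
  obtain ⟨ε, hε0, hε⟩ := exists_isSmallParam hb.m_pos hb.C_pos
  have hε' : ∀ t ∈ Ioo 0 ε, IsSmallParam m C t := fun t ht => hε t (Ioo_subset_Icc_self ht)
  classical
  let Mt : ℝ → HypDisk n := fun t =>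
    if ht : t ∈ Ioo 0 ε then perturbDisk hb (hε' t ht) else S
  have hMt : ∀ t (ht : t ∈ Ioo 0 ε), Mt t = perturbDisk hb (hε' t ht) := fun t ht => dif_pos ht
  have hn' : (0 : ℝ) ≤ (n : ℝ) - 1 := by
    rw [sub_nonneg]
    exact_mod_cast hn
  refine ⟨ε, hε0, Mt, fun t ht => ?_, ?_, ?_, ?_⟩
  · rw [hMt t ht]
    exact ⟨perturbDisk_strictlyConvex hb _ hconv ht.1, perturbDisk_perpFromInside hb _ hperp⟩
  · refine (hb.tendsto_integral_perturbDensity hε0 hε).congr' ?_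
    filter_upwards [self_mem_nhdsWithin] with t ht
    rw [hMt t ht, surfIntegral_perturbDisk]
  · refine (hb.tendsto_hausdorffMeasure hε' subset_rfl n.cast_nonneg).congr' ?_
    filter_upwards [self_mem_nhdsWithin] with t ht
    rw [hMt t ht]
    rfl
  · refine (hb.tendsto_hausdorffMeasure hε' diskBdry_subset_disk hn').congr' ?_
    filter_upwards [self_mem_nhdsWithin] with t ht
    rw [hMt t ht]
    rfl

end
end
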